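/- Let t be an integer and G=(X,Y;E) a bipartite graph with |X| = n and |Y| = m, where n ≥ m ≥ t ≥ 2. If either m ≤ 2t−2 and e(G) > (n−1)(t−1)+m, or m ≥ 2t−2 and e(G) > (m+n−2t+3)(t−1), then G contains a cycle of length at least 2t. -/

import Mathlib

namespace JacksonCycle

open Finset

/-- `l` lists, in order, the vertices of a path of `G` from `a` to `b`. -/
structure IsPathList {V : Type*} (G : SimpleGraph V) (a b : V) (l : List V) : Prop where
  chain : l.IsChain G.Adj
  nodup : l.Nodup
  head : l.head? = some a
  last : l.getLast? = some b

/-- `l` lists, in cyclic order, the vertices of a cycle of `G` (or of a single edge). -/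
def IsCycleList {V : Type*} (G : SimpleGraph V) (l : List V) : Prop :=
  ∃ a b, IsPathList G a b l ∧ G.Adj b a

/-- `G` has no cycle with at least `2 * s + 2` vertices. -/
def NoLongCycle {V : Type*} (G : SimpleGraph V) (s : ℕ) : Prop :=
  ∀ l, IsCycleList G l → l.length < 2 * s + 2

section Paths

variable {V : Type*} {G H : SimpleGraph V} {a b c d : V} {l l' : List V}

namespace IsPathList

theorem ne_nil (h : IsPathList G a b l) : l ≠ [] := by
  rintro rfl; simpa using h.head

theorem head_mem (h : IsPathList G a b l) : a ∈ l := List.mem_of_mem_head? h.head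

theorem last_mem (h : IsPathList G a b l) : b ∈ l := List.mem_of_getLast? h.last

theorem length_pos (h : IsPathList G a b l) : 0 < l.length := List.length_pos_iff.2 h.ne_nil

theorem single (a : V) : IsPathList G a a [a] := ⟨by simp, by simp, by simp, by simp⟩

theorem append (h : IsPathList G a b l) (h' : IsPathList G c d l') (hbc : G.Adj b c)
    (hd : ∀ x ∈ l, x ∉ l') : IsPathList G a d (l ++ l') := by
  refine ⟨List.isChain_append.2 ⟨h.chain, h'.chain, ?_⟩,
    List.nodup_append.2 ⟨h.nodup, h'.nodup, ?_⟩, ?_, ?_⟩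
  · simpa [h.last, h'.head] using hbc
  · rintro x hx _ hy rfl
    exact hd x hx hy
  · simp [List.head?_append, h.head]
  · simp [List.getLast?_append, h'.last]

theorem reverse (h : IsPathList G a b l) : IsPathList G b a l.reverse :=
  ⟨List.isChain_reverse.2 (h.chain.imp fun _ _ h => h.symm), List.nodup_reverse.2 h.nodup,
    by simp [h.last], by simp [h.head]⟩

theorem mono (hGH : G ≤ H) (h : IsPathList G a b l) : IsPathList H a b l :=
  ⟨h.chain.imp fun _ _ h => hGH h, h.nodup, h.head, h.last⟩

theorem concat (h : IsPathList G a b l) (hbc : G.Adj b c) (hc : c ∉ l) :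
    IsPathList G a c (l ++ [c]) :=
  h.append (single c) hbc fun x hx hx' => hc (by simp at hx'; exact hx' ▸ hx)

theorem cons (h : IsPathList G a b l) (hca : G.Adj c a) (hc : c ∉ l) :
    IsPathList G c b (c :: l) :=
  (single c).append h hca fun x hx hx' => hc (by simp at hx; exact hx ▸ hx')

theorem left_of_append {l₁ l₂ : List V} (h : IsPathList G a b (l₁ ++ c :: l₂)) :
    IsPathList G a c (l₁ ++ [c]) := by
  have e : l₁ ++ c :: l₂ = (l₁ ++ [c]) ++ l₂ := by simp
  refine ⟨(List.isChain_split.1 h.chain).1, ?_, ?_, by simp⟩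
  · have := h.nodup
    rw [e] at this
    exact (List.nodup_append.1 this).1
  · have := h.head
    cases l₁ <;> simpa using this

theorem right_of_append {l₁ l₂ : List V} (h : IsPathList G a b (l₁ ++ c :: l₂)) :
    IsPathList G c b (c :: l₂) := by
  refine ⟨(List.isChain_split.1 h.chain).2, ?_, by simp, ?_⟩
  · exact (List.nodup_append.1 h.nodup).2.1
  · have := h.last
    rw [List.getLast?_append] at this
    simpa using this

theorem isCycleList (h : IsPathList G a b l) (hba : G.Adj b a) : IsCycleList G l :=
  ⟨a, b, h, hba⟩

end IsPathList

theorem NoLongCycle.anti {s : ℕ} (h : NoLongCycle H s) (hGH : G ≤ H) : NoLongCycle G s := by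
  rintro l ⟨a, b, hl, hba⟩
  exact h l ⟨a, b, hl.mono hGH, hGH hba⟩

end Paths

/-- The vertices `v 0, …, v L` are distinct and consecutive ones are adjacent. -/
structure IsPathFun {V : Type*} (G : SimpleGraph V) (v : ℕ → V) (L : ℕ) : Prop where
  adj : ∀ i < L, G.Adj (v i) (v (i + 1))
  inj : ∀ i ≤ L, ∀ j ≤ L, v i = v j → i = j

/-- The list `v a, …, v b`. -/
def segment {V : Type*} (v : ℕ → V) (a b : ℕ) : List V := (List.range' a (b + 1 - a)).map v

section Segment

variable {V : Type*} {G : SimpleGraph V} {v : ℕ → V} {L a b : ℕ}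

theorem mem_segment {x : V} : x ∈ segment v a b ↔ ∃ i, a ≤ i ∧ i ≤ b ∧ v i = x := by
  simp only [segment, List.mem_map, List.mem_range'_1]
  constructor
  · rintro ⟨i, hi, rfl⟩
    exact ⟨i, by omega, by omega, rfl⟩
  · rintro ⟨i, h1, h2, rfl⟩
    exact ⟨i, by omega, rfl⟩

@[simp] theorem length_segment : (segment v a b).length = b + 1 - a := by simp [segment]

theorem IsPathFun.segment (h : IsPathFun G v L) (hab : a ≤ b) (hb : b ≤ L) :
    IsPathList G (v a) (v b) (segment v a b) := by
  refine ⟨?_, ?_, ?_, ?_⟩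
  · rw [JacksonCycle.segment, List.isChain_map, List.isChain_iff_getElem]
    intro i hi
    simp only [List.length_range'] at hi
    simpa [add_assoc] using h.adj (a + i) (by omega)
  · refine List.Nodup.map_on ?_ (List.nodup_range')
    intro x hx y hy hxy
    simp only [List.mem_range'_1] at hx hy
    exact h.inj x (by omega) y (by omega) hxy
  · have : b + 1 - a = (b - a) + 1 := by omega
    simp [JacksonCycle.segment, this, List.range'_succ]
  · have : b + 1 - a = (b - a) + 1 := by omega
    rw [JacksonCycle.segment, this, List.range'_1_concat, List.map_append,
      List.map_singleton, List.getLast?_concat]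
    congr 2
    omega

theorem IsPathFun.disjoint_segment (h : IsPathFun G v L) {c d : ℕ} (hbL : b ≤ L) (hd : d ≤ L)
    (hbc : b < c ∨ d < a) :
    ∀ x ∈ JacksonCycle.segment v a b, x ∉ JacksonCycle.segment v c d := by
  intro x hx hy
  obtain ⟨i, h1, h2, rfl⟩ := mem_segment.1 hx
  obtain ⟨j, h3, h4, hij⟩ := mem_segment.1 hy
  have := h.inj j (by omega) i (by omega) hij
  omega

theorem IsPathList.exists_isPathFun {x y : V} {l : List V} (h : IsPathList G x y l) :
    ∃ v : ℕ → V, IsPathFun G v (l.length - 1) ∧ v 0 = x ∧ v (l.length - 1) = y ∧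
      ∀ z, z ∈ l ↔ ∃ i < l.length, v i = z := by
  have hpos := h.length_pos
  have key : ∀ i (hi : i < l.length), l.getD i x = l[i] := by
    intro i hi; simp [List.getD, hi]
  refine ⟨fun i => l.getD i x, ⟨?_, ?_⟩, ?_, ?_, ?_⟩
  · intro i hi
    have := List.isChain_iff_getElem.1 h.chain i (by omega)
    rw [key i (by omega), key (i + 1) (by omega)]
    exact this
  · intro i hi j hj hij
    rw [key i (by omega), key j (by omega)] at hij
    exact (h.nodup.getElem_inj_iff).1 hij
  · have := h.head
    rw [List.head?_eq_getElem?] at this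
    simp [List.getD, this]
  · have := h.last
    rw [List.getLast?_eq_getElem?] at this
    simp [List.getD, this]
  · intro z
    rw [List.mem_iff_getElem]
    constructor
    · rintro ⟨i, hi, rfl⟩
      exact ⟨i, hi, key i hi⟩
    · rintro ⟨i, hi, rfl⟩
      exact ⟨i, hi, (key i hi).symm⟩

end Segment

open scoped Classical in
/-- The neighbours of `x` in `Y`. -/
noncomputable def nbrs {V : Type*} (G : SimpleGraph V) (Y : Finset V) (x : V) : Finset V :=
  {y ∈ Y | G.Adj x y}

/-- The subgraph of the edges between `X` and `Y`. -/
def between {V : Type*} (G : SimpleGraph V) (X Y : Finset V) : SimpleGraph V where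
  Adj u v := G.Adj u v ∧ (u ∈ X ∧ v ∈ Y ∨ u ∈ Y ∧ v ∈ X)
  symm := ⟨fun _ _ h => ⟨h.1.symm, by tauto⟩⟩
  loopless := ⟨fun _ h => h.1.ne rfl⟩

section Bipartite

variable {V : Type*} {G : SimpleGraph V} {X Y X' Y' : Finset V} {x y : V} {s : ℕ}

@[simp] theorem mem_nbrs : y ∈ nbrs G Y x ↔ y ∈ Y ∧ G.Adj x y := by simp [nbrs]

theorem nbrs_subset : nbrs G Y x ⊆ Y := fun _ h => (mem_nbrs.1 h).1

theorem between_le : between G X Y ≤ G := fun _ _ h => h.1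

theorem between_isBipartiteWith (h : Disjoint X Y) : (between G X Y).IsBipartiteWith X Y :=
  ⟨by exact_mod_cast h, fun _ _ h => h.2⟩

theorem nbrs_between (hx : x ∈ X) : nbrs (between G X Y) Y x = nbrs G Y x := by
  ext y
  simp only [mem_nbrs, between]
  tauto

theorem mem_right (hb : G.IsBipartiteWith X Y) (hx : x ∈ X) (h : G.Adj x y) : y ∈ Y :=
  hb.mem_of_mem_adj hx h

theorem mem_left (hb : G.IsBipartiteWith X Y) (hy : y ∈ Y) (h : G.Adj y x) : x ∈ X :=
  hb.symm.mem_of_mem_adj hy h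

theorem ne_of_mem (hb : G.IsBipartiteWith X Y) (hx : x ∈ X) (hy : y ∈ Y) : x ≠ y := by
  rintro rfl
  exact Set.disjoint_left.1 hb.disjoint hx hy

theorem IsPathFun.mem_of_even (hb : G.IsBipartiteWith X Y) {v : ℕ → V} {L : ℕ}
    (h : IsPathFun G v L) (h0 : v 0 ∈ X) :
    ∀ i, (2 * i ≤ L → v (2 * i) ∈ X) ∧ (2 * i + 1 ≤ L → v (2 * i + 1) ∈ Y) := by
  intro i
  induction i with
  | zero => exact ⟨fun _ => h0, fun h1 => mem_right hb h0 (h.adj 0 (by omega))⟩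
  | succ k ih =>
    have h2 : 2 * (k + 1) ≤ L → v (2 * (k + 1)) ∈ X := fun h1 =>
      mem_left hb (ih.2 (by omega)) (h.adj (2 * k + 1) (by omega))
    exact ⟨h2, fun h1 => mem_right hb (h2 (by omega)) (h.adj (2 * (k + 1)) (by omega))⟩

theorem exists_common_nbrs (hdeg : ∀ x ∈ X, s + 1 ≤ #(nbrs G Y x)) (hY : #Y ≤ 2 * s)
    {x₁ x₂ : V} (h₁ : x₁ ∈ X) (h₂ : x₂ ∈ X) (z : V) :
    ∃ y ∈ Y, y ≠ z ∧ G.Adj x₁ y ∧ G.Adj x₂ y := by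
  classical
  have h := card_union_add_card_inter (nbrs G Y x₁) (nbrs G Y x₂)
  have hu : #(nbrs G Y x₁ ∪ nbrs G Y x₂) ≤ #Y :=
    card_le_card (union_subset nbrs_subset nbrs_subset)
  have := hdeg _ h₁
  have := hdeg _ h₂
  have h1 : 1 < #(nbrs G Y x₁ ∩ nbrs G Y x₂) := by omega
  obtain ⟨y, hy, hyz⟩ := exists_mem_ne h1 z
  simp only [mem_inter, mem_nbrs] at hy
  exact ⟨y, hy.1.1, hyz, hy.1.2, hy.2.2⟩

/-- A cycle with `2 * c` vertices, `c ≤ s`, can be replaced by one with two more vertices. -/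
theorem exists_longer_cycle (hb : G.IsBipartiteWith X Y)
    (hdeg : ∀ x ∈ X, s + 1 ≤ #(nbrs G Y x)) (hY : #Y ≤ 2 * s) (hX : s + 1 ≤ #X)
    {c : ℕ} (hc : 2 ≤ c) (hcs : c ≤ s) {a b : V} {l : List V} (hl : IsPathList G a b l)
    (hba : G.Adj b a) (ha : a ∈ X) (hlen : l.length = 2 * c) :
    ∃ a b l, IsPathList G a b l ∧ G.Adj b a ∧ a ∈ X ∧ l.length = 2 * (c + 1) := by
  classical
  by_contra! hno
  obtain ⟨v, hv, hv0, hvL, -⟩ := hl.exists_isPathFun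
  rw [hlen] at hv hvL
  subst hv0 hvL
  have hpar := hv.mem_of_even hb ha
  obtain ⟨x, hx, hxC⟩ : ∃ x ∈ X, x ∉ (range c).image fun k => v (2 * k) := by
    apply exists_mem_notMem_of_card_lt_card
    exact lt_of_le_of_lt card_image_le (by simp; omega)
  have hxv : ∀ i, i ≤ 2 * c - 1 → x ≠ v i := by
    rintro i hi rfl
    rcases Nat.even_or_odd' i with ⟨k, rfl | rfl⟩
    · exact hxC (mem_image.2 ⟨k, mem_range.2 (by omega), rfl⟩)
    · exact ne_of_mem hb hx ((hpar k).2 hi) rfl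
  have hxs : ∀ i j, j ≤ 2 * c - 1 → x ∉ segment v i j := by
    intro i j hj hm
    obtain ⟨k, _, hk, hkx⟩ := mem_segment.1 hm
    exact hxv k (by omega) hkx.symm
  set O := (range c).image fun k => v (2 * k + 1) with hO
  have hOY : O ⊆ Y := by
    intro z hz
    obtain ⟨k, hk, rfl⟩ := mem_image.1 hz
    have := mem_range.1 hk
    exact (hpar k).2 (by omega)
  have hOc : #O = c := by
    rw [hO, card_image_of_injOn, card_range]
    intro i hi j hj hij
    simp only [coe_range, Set.mem_Iio] at hi hj
    have := hv.inj _ (by omega) _ (by omega) hij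
    omega
  have hyv : ∀ y ∈ Y, y ∉ O → ∀ i, i ≤ 2 * c - 1 → y ≠ v i := by
    rintro _ hy hyO i hi rfl
    rcases Nat.even_or_odd' i with ⟨k, rfl | rfl⟩
    · exact ne_of_mem hb ((hpar k).1 hi) hy rfl
    · exact hyO (mem_image.2 ⟨k, mem_range.2 (by omega), rfl⟩)
  have hys : ∀ y ∈ Y, y ∉ O → ∀ i j, j ≤ 2 * c - 1 → y ∉ segment v i j := by
    intro y hy hyO i j hj hm
    obtain ⟨k, _, hk, hkx⟩ := mem_segment.1 hm
    exact hyv y hy hyO k (by omega) hkx.symm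
  set D := {k ∈ range c | G.Adj x (v (2 * k + 1))} with hD
  have hseg : ∀ i j, i ≤ j → j ≤ 2 * c - 1 → IsPathList G (v i) (v j) (segment v i j) :=
    fun i j hij hj => hv.segment hij hj
  -- the arc of the cycle from `v (2 * k + 1)` around to `v j`
  have harc : ∀ i j, j < i → i ≤ 2 * c - 1 →
      IsPathList G (v i) (v j) (segment v i (2 * c - 1) ++ segment v 0 j) := fun i j h h' =>
    (hseg i _ h' le_rfl).append (hseg 0 j (by omega) (by omega)) hba
      (hv.disjoint_segment le_rfl (by omega) (by omega))
  have hxd : ∀ k ∈ D, ∀ y ∈ Y, y ∉ O → G.Adj x y → ¬ G.Adj (v (2 * k)) y := by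
    intro k hk y hy hyO hxy hky
    simp only [hD, mem_filter, mem_range] at hk
    refine hno _ _ _ (((harc (2 * k + 1) (2 * k) (by omega) (by omega)).concat hky ?_).cons hk.2 ?_)
      hxy.symm hx ?_
    · have h1 := hys y hy hyO 0 (2 * k) (by omega)
      simp [hys y hy hyO, h1]
    · have h1 := hxs 0 (2 * k) (by omega)
      simp [hxs, h1, ne_of_mem hb hx hy]
    · simp; omega
  have hvd : ∀ k ∈ D, ∀ j ∈ D, k < j → ∀ y ∈ Y, y ∉ O → G.Adj (v (2 * k)) y →
      ¬ G.Adj (v (2 * j)) y := by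
    intro k hk j hj hkj y hy hyO hky hjy
    simp only [hD, mem_filter, mem_range] at hk hj
    refine hno _ _ _ (((((hseg (2 * k + 1) (2 * j) (by omega) (by omega)).concat hjy ?_).append
      (harc (2 * j + 1) (2 * k) (by omega) (by omega)).reverse hky.symm ?_)).cons hk.2 ?_)
      hj.2.symm hx ?_
    · exact hys y hy hyO _ _ (by omega)
    · intro z hz hz'
      simp only [List.mem_append, List.mem_singleton, List.mem_reverse] at hz hz'
      rcases hz with hz | rfl
      · rcases hz' with hz' | hz'
        · exact hv.disjoint_segment (by omega) le_rfl (by omega) z hz hz'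
        · exact hv.disjoint_segment (by omega) (by omega) (by omega) z hz hz'
      · rcases hz' with hz' | hz'
        · exact hys z hy hyO _ _ (by omega) hz'
        · exact hys z hy hyO _ _ (by omega) hz'
    · have h1 := hxs (2 * k + 1) (2 * j) (by omega)
      have h2 := hxs (2 * j + 1) (2 * c - 1) (by omega)
      have h3 := hxs 0 (2 * k) (by omega)
      simp [h1, h2, h3, ne_of_mem hb hx hy]
    · simp; omega
  have hDne : D.Nonempty := by
    by_contra hDe
    have hxO : ∀ y ∈ O, ¬ G.Adj x y := by
      intro y hy hxy
      obtain ⟨k, hk, rfl⟩ := mem_image.1 hy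
      exact hDe ⟨k, mem_filter.2 ⟨hk, hxy⟩⟩
    obtain ⟨y, hy, -, hxy, h0y⟩ := exists_common_nbrs hdeg hY hx ha x
    obtain ⟨y', hy', hne, hxy', h2y'⟩ :=
      exists_common_nbrs hdeg hY hx ((hpar 1).1 (by omega)) y
    have hyO : y ∉ O := fun h => hxO y h hxy
    have hyO' : y' ∉ O := fun h => hxO y' h hxy'
    refine hno _ _ _ (((((hseg 2 (2 * c - 1) (by omega) le_rfl).append (hseg 0 0 (by omega)
      (by omega)) hba ?_).concat h0y ?_).cons h2y'.symm ?_).cons hxy' ?_) hxy.symm hx ?_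
    · exact hv.disjoint_segment le_rfl (by omega) (by omega)
    · simp [hys y hy hyO]
    · simp [hys y' hy' hyO', hne]
    · simp [hxs, ne_of_mem hb hx hy, ne_of_mem hb hx hy']
    · simp; omega
  have hdeg' : ∀ u ∈ X, s + 1 - c ≤ #(nbrs G (Y \ O) u) := by
    intro u hu
    have h1 : nbrs G Y u ⊆ nbrs G (Y \ O) u ∪ O := by
      intro z hz
      simp only [mem_nbrs, mem_union, mem_sdiff] at hz ⊢
      tauto
    have h2 := (card_le_card h1).trans (card_union_le _ _)
    have := hdeg u hu
    omega
  have hdegx : s + 1 ≤ #(nbrs G (Y \ O) x) + #D := by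
    have h1 : nbrs G Y x ⊆ nbrs G (Y \ O) x ∪ D.image fun k => v (2 * k + 1) := by
      intro z hz
      simp only [mem_nbrs, mem_union, mem_sdiff] at hz ⊢
      by_cases hzO : z ∈ O
      · right
        obtain ⟨k, hk, rfl⟩ := mem_image.1 hzO
        exact mem_image.2 ⟨k, mem_filter.2 ⟨hk, hz.2⟩, rfl⟩
      · tauto
    have h2 := (card_le_card h1).trans (card_union_le _ _)
    have h3 : #(D.image fun k => v (2 * k + 1)) ≤ #D := card_image_le
    have := hdeg x hx
    omega
  have hDc : #D ≤ c := (card_filter_le _ _).trans (by simp)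
  have hdisj1 : (D : Set ℕ).PairwiseDisjoint fun k => nbrs G (Y \ O) (v (2 * k)) := by
    intro k hk j hj hkj
    rw [Function.onFun, disjoint_left]
    intro y hy hy'
    simp only [mem_nbrs, mem_sdiff] at hy hy'
    rcases lt_or_gt_of_ne hkj with h | h
    · exact hvd k hk j hj h y hy.1.1 hy.1.2 hy.2 hy'.2
    · exact hvd j hj k hk h y hy.1.1 hy.1.2 hy'.2 hy.2
  have hdisj2 : Disjoint (nbrs G (Y \ O) x) (D.biUnion fun k => nbrs G (Y \ O) (v (2 * k))) := by
    rw [disjoint_left]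
    intro y hy hy'
    obtain ⟨k, hk, hy'⟩ := mem_biUnion.1 hy'
    simp only [mem_nbrs, mem_sdiff] at hy hy'
    exact hxd k hk y hy.1.1 hy.1.2 hy.2 hy'.2
  have hsub : nbrs G (Y \ O) x ∪ (D.biUnion fun k => nbrs G (Y \ O) (v (2 * k))) ⊆ Y \ O :=
    union_subset nbrs_subset (biUnion_subset.2 fun _ _ => nbrs_subset)
  have hcard := card_le_card hsub
  rw [card_union_of_disjoint hdisj2, card_biUnion hdisj1, card_sdiff_of_subset hOY, hOc] at hcard
  have hsum : #D * (s + 1 - c) ≤ ∑ k ∈ D, #(nbrs G (Y \ O) (v (2 * k))) := by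
    rw [← smul_eq_mul]
    refine card_nsmul_le_sum _ _ _ fun k hk => hdeg' _ ((hpar k).1 ?_)
    have := mem_range.1 (mem_filter.1 hk).1
    omega
  have hDpos : 1 ≤ #D := hDne.card_pos
  obtain ⟨e, rfl⟩ := Nat.exists_eq_add_of_le hcs
  rw [show c + e + 1 - c = e + 1 by omega] at hsum
  rw [mul_add] at hsum
  have := Nat.mul_le_mul_right e hDpos
  omega

/-- If every vertex of `X` has more than `s` neighbours in the set `Y` of size at most `2 * s`, there
is a cycle with `2 * s + 2` vertices. -/
theorem exists_cycle_of_le_card_nbrs (hb : G.IsBipartiteWith X Y) (hs : 1 ≤ s)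
    (hdeg : ∀ x ∈ X, s + 1 ≤ #(nbrs G Y x)) (hY : #Y ≤ 2 * s) (hX : s + 1 ≤ #X) :
    ∃ l, IsCycleList G l ∧ l.length = 2 * s + 2 := by
  have key : ∀ c, c < s → ∃ a b l, IsPathList G a b l ∧ G.Adj b a ∧ a ∈ X ∧
      l.length = 2 * (c + 2) := by
    intro c
    induction c with
    | zero =>
      intro _
      obtain ⟨x₁, h₁, x₂, h₂, hne⟩ := one_lt_card.1 (show 1 < #X by omega)
      obtain ⟨y, hy, -, h1y, h2y⟩ := exists_common_nbrs hdeg hY h₁ h₂ x₁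
      obtain ⟨y', hy', hyy, h1y', h2y'⟩ := exists_common_nbrs hdeg hY h₁ h₂ y
      refine ⟨_, _, _, (((IsPathList.single y').cons h2y' ?_).cons h2y.symm ?_).cons h1y ?_,
        h1y'.symm, h₁, by simp⟩
      · simp [ne_of_mem hb h₂ hy']
      · simp [(ne_of_mem hb h₂ hy).symm, hyy.symm]
      · simp [hne, ne_of_mem hb h₁ hy, ne_of_mem hb h₁ hy']
    | succ c ih =>
      intro hc
      obtain ⟨a, b, l, hl, hba, ha, hlen⟩ := ih (by omega)
      exact exists_longer_cycle hb hdeg hY hX (by omega) (by omega) hl hba ha hlen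
  obtain ⟨a, b, l, hl, hba, -, hlen⟩ := key (s - 1) (by omega)
  exact ⟨l, ⟨a, b, hl, hba⟩, by omega⟩

end Bipartite

/-- The number of edges between `X` and `Y`, counted from the side of `X`. -/
noncomputable def edgeCount {V : Type*} (G : SimpleGraph V) (X Y : Finset V) : ℕ :=
  ∑ x ∈ X, #(nbrs G Y x)

section EdgeCount

variable {V : Type*} {G H : SimpleGraph V} {X Y : Finset V}

theorem edgeCount_comm : edgeCount G X Y = edgeCount G Y X := by
  classical
  have h := sum_card_bipartiteAbove_eq_sum_card_bipartiteBelow (s := X) (t := Y) G.Adj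
  have h1 : ∀ y, bipartiteBelow G.Adj X y = nbrs G X y := fun y => by
    ext; simp [bipartiteBelow, G.adj_comm]
  have h2 : ∀ x, bipartiteAbove G.Adj Y x = nbrs G Y x := fun x => by
    ext; simp [bipartiteAbove]
  simp only [h1, h2] at h
  exact h

theorem edgeCount_le_mul : edgeCount G X Y ≤ #X * #Y := by
  rw [← smul_eq_mul]
  exact sum_le_card_nsmul _ _ _ fun x _ => card_le_card nbrs_subset

theorem edgeCount_mono (h : G ≤ H) : edgeCount G X Y ≤ edgeCount H X Y :=
  sum_le_sum fun _ _ => card_le_card fun _ hy =>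
    mem_nbrs.2 ⟨(mem_nbrs.1 hy).1, h (mem_nbrs.1 hy).2⟩

theorem edgeCount_between : edgeCount (between G X Y) X Y = edgeCount G X Y :=
  sum_congr rfl fun _ hx => by rw [nbrs_between hx]

theorem edgeCount_erase_left [DecidableEq V] {x : V} (hx : x ∈ X) :
    edgeCount G X Y = edgeCount G (X.erase x) Y + #(nbrs G Y x) :=
  (sum_erase_add _ _ hx).symm

theorem edgeCount_erase_right [DecidableEq V] {y : V} (hy : y ∈ Y) :
    edgeCount G X Y = edgeCount G X (Y.erase y) + #(nbrs G X y) := by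
  rw [edgeCount_comm, edgeCount_erase_left hy, edgeCount_comm]

/-- If `G[X, Y]` has many edges, it contains a subgraph `G[A, B]` with prescribed minimum degrees
on both sides. -/
theorem exists_core (α β : ℕ) (hG : α * #X + β * #Y + (β - #X) * (α - #Y) <
    edgeCount G X Y + α * β) :
    ∃ A ⊆ X, ∃ B ⊆ Y, A.Nonempty ∧ B.Nonempty ∧
      (∀ x ∈ A, α < #(nbrs G B x)) ∧ ∀ y ∈ B, β < #(nbrs G A y) := by
  classical
  induction hN : #X + #Y generalizing X Y with
  | zero =>
    have h1 : #X = 0 := by omega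
    have h2 : #Y = 0 := by omega
    have := edgeCount_le_mul (G := G) (X := X) (Y := Y)
    rw [h1, h2] at hG
    rw [h1] at this
    simp [mul_comm β α] at hG this
    omega
  | succ N ih =>
    by_cases hx : ∃ x ∈ X, #(nbrs G Y x) ≤ α
    · obtain ⟨x, hx, hd⟩ := hx
      have he := edgeCount_erase_left (G := G) (Y := Y) hx
      have hc := card_erase_add_one hx
      obtain ⟨A, hA, B, hB, h⟩ := ih (X := X.erase x) (Y := Y) (by
        have hq : #(nbrs G Y x) ≤ #Y := card_le_card nbrs_subset
        rw [← hc] at hG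
        set p := #(X.erase x)
        rcases le_or_gt (p + 1) β with h | h
        · obtain ⟨r, rfl⟩ := Nat.exists_eq_add_of_le h
          rw [show p + 1 + r - (p + 1) = r by omega] at hG
          rw [show p + 1 + r - p = r + 1 by omega, add_mul r 1, one_mul]
          rw [mul_add α p 1] at hG
          omega
        · rw [show β - p = 0 by omega]
          rw [show β - (p + 1) = 0 by omega, mul_add α p 1] at hG
          omega) (by omega)
      exact ⟨A, hA.trans (erase_subset _ _), B, hB, h⟩
    · by_cases hy : ∃ y ∈ Y, #(nbrs G X y) ≤ β
      · obtain ⟨y, hy, hd⟩ := hy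
        have he := edgeCount_erase_right (G := G) (X := X) hy
        have hc := card_erase_add_one hy
        obtain ⟨A, hA, B, hB, h⟩ := ih (X := X) (Y := Y.erase y) (by
          have hq : #(nbrs G X y) ≤ #X := card_le_card nbrs_subset
          rw [← hc] at hG
          set p := #(Y.erase y)
          rcases le_or_gt (p + 1) α with h | h
          · obtain ⟨r, rfl⟩ := Nat.exists_eq_add_of_le h
            rw [show p + 1 + r - (p + 1) = r by omega] at hG
            rw [show p + 1 + r - p = r + 1 by omega, mul_add _ r 1, mul_one]
            rw [mul_add β p 1] at hG
            omega
          · rw [show α - p = 0 by omega]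
            rw [show α - (p + 1) = 0 by omega, mul_add β p 1] at hG
            omega) (by omega)
        exact ⟨A, hA, B, hB.trans (erase_subset _ _), h⟩
      · push Not at hx hy
        refine ⟨X, subset_rfl, Y, subset_rfl, ?_, ?_, hx, hy⟩
        · by_contra h
          obtain ⟨y, hyY⟩ : Y.Nonempty := by
            rw [← card_pos]; rw [not_nonempty_iff_eq_empty] at h; simp [h] at hN; omega
          have h1 := hy y hyY
          have h2 : #(nbrs G X y) ≤ #X := card_le_card nbrs_subset
          rw [not_nonempty_iff_eq_empty] at h; simp [h] at h2; simp [h, h2] at h1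
        · by_contra h
          obtain ⟨x, hxX⟩ : X.Nonempty := by
            rw [← card_pos]; rw [not_nonempty_iff_eq_empty] at h; simp [h] at hN; omega
          have h1 := hx x hxX
          have h2 : #(nbrs G Y x) ≤ #Y := card_le_card nbrs_subset
          rw [not_nonempty_iff_eq_empty] at h; simp [h] at h2; simp [h, h2] at h1

/-- If `G[X, Y]` can be reduced to `G[X₀, Y₀]` by deleting vertices of degree at most `α` from `X`
and at most `β` from `Y`, then it has few edges. -/
theorem edgeCount_le_of_removable {X₀ Y₀ : Finset V} (α β : ℕ) (hX : X₀ ⊆ X) (hY : Y₀ ⊆ Y)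
    (h : ∀ A B, X₀ ⊆ A → A ⊆ X → Y₀ ⊆ B → B ⊆ Y → (A ≠ X₀ ∨ B ≠ Y₀) →
      (∃ x ∈ A, x ∉ X₀ ∧ #(nbrs G B x) ≤ α) ∨ ∃ y ∈ B, y ∉ Y₀ ∧ #(nbrs G A y) ≤ β) :
    edgeCount G X Y ≤ #X₀ * #Y₀ + α * (#X - #X₀) + β * (#Y - #Y₀) := by
  classical
  induction hN : #X + #Y generalizing X Y with
  | zero =>
    refine edgeCount_le_mul.trans ?_
    have h1 : #X = 0 := by omega
    simp [h1]
  | succ N ih =>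
    by_cases hne : X ≠ X₀ ∨ Y ≠ Y₀
    · rcases h X Y hX subset_rfl hY subset_rfl hne with ⟨x, hx, hx0, hd⟩ | ⟨y, hy, hy0, hd⟩
      · have he := edgeCount_erase_left (G := G) (Y := Y) hx
        have hc := card_erase_add_one hx
        have hsub : X₀ ⊆ X.erase x := subset_erase.2 ⟨hX, hx0⟩
        have := ih hsub hY (fun A B h1 h2 => h A B h1 (h2.trans (erase_subset _ _))) (by omega)
        have hle := card_le_card hsub
        rw [he, ← hc, show #(X.erase x) + 1 - #X₀ = #(X.erase x) - #X₀ + 1 by omega, mul_add α]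
        omega
      · have he := edgeCount_erase_right (G := G) (X := X) hy
        have hc := card_erase_add_one hy
        have hsub : Y₀ ⊆ Y.erase y := subset_erase.2 ⟨hY, hy0⟩
        have := ih hX hsub (fun A B h1 h2 h3 h4 => h A B h1 h2 h3 (h4.trans (erase_subset _ _)))
          (by omega)
        have hle := card_le_card hsub
        rw [he, ← hc, show #(Y.erase y) + 1 - #Y₀ = #(Y.erase y) - #Y₀ + 1 by omega, mul_add β]
        omega
    · push Not at hne
      obtain ⟨rfl, rfl⟩ := hne
      have := edgeCount_le_mul (G := G) (X := X) (Y := Y)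
      omega

end EdgeCount

/-- No vertex of `W` separates two other vertices of `W`. -/
def NoCutVertex {V : Type*} (G : SimpleGraph V) (W : Set V) : Prop :=
  ∀ w, ∀ S ⊆ W, S.Nonempty → w ∉ S → (∃ z ∈ W, z ∉ S ∧ z ≠ w) →
    ∃ a ∈ S, ∃ b ∈ W, b ∉ S ∧ b ≠ w ∧ G.Adj a b

section Linkage

variable {V : Type*} {G : SimpleGraph V} {a b c : V} {l P Q : List V}

theorem IsPathList.exists_prefix (h : IsPathList G a b l) (hc : c ∈ l) :
    ∃ P, IsPathList G a c P ∧ (∀ x ∈ P, x ∈ l) ∧ (b ∈ P → b = c) ∧ P.length ≤ l.length ∧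
      (c ≠ b → P.length < l.length) := by
  obtain ⟨l₁, l₂, rfl⟩ := List.append_of_mem hc
  have hb := h.right_of_append.last_mem
  have hnd := List.nodup_append.1 h.nodup
  refine ⟨_, h.left_of_append, fun x hx => ?_, fun hb' => ?_, by simp, fun hne => ?_⟩
  · simp only [List.mem_append, List.mem_cons] at hx ⊢
    tauto
  · simp only [List.mem_append, List.mem_singleton] at hb'
    rcases hb' with hb' | hb'
    · exact absurd rfl (hnd.2.2 _ hb' _ hb)
    · exact hb'
  · simp only [List.mem_cons] at hb
    have := List.length_pos_of_mem (hb.resolve_left hne.symm)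
    simp; omega

theorem IsPathList.exists_suffix (h : IsPathList G a b l) (hc : c ∈ l) :
    ∃ P, IsPathList G c b P ∧ (∀ x ∈ P, x ∈ l) ∧ (c ≠ a → P.length < l.length) := by
  obtain ⟨P, hP, h1, -, -, h3⟩ := h.reverse.exists_prefix (List.mem_reverse.2 hc)
  exact ⟨_, hP.reverse, by simpa using h1, by simpa using h3⟩

theorem IsPathList.glue (h : IsPathList G a b P) (h' : IsPathList G b c Q)
    (hd : ∀ x ∈ P, x ∈ Q → x = b) :
    ∃ R, IsPathList G a c R ∧ R.length + 1 = P.length + Q.length ∧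
      ∀ x, x ∈ R ↔ x ∈ P ∨ x ∈ Q := by
  obtain ⟨r, rfl⟩ : ∃ r, Q = b :: r := List.head?_eq_some_iff.1 h'.head
  refine ⟨P ++ r, ⟨List.isChain_append.2 ⟨h.chain, (List.isChain_cons.1 h'.chain).2, ?_⟩,
    List.nodup_append.2 ⟨h.nodup, (List.nodup_cons.1 h'.nodup).2, ?_⟩, ?_, ?_⟩, ?_, ?_⟩
  · rw [h.last]
    rintro x hx
    obtain rfl := Option.mem_some_iff.1 hx
    exact (List.isChain_cons.1 h'.chain).1
  · rintro x hx _ hy rfl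
    have := hd x hx (List.mem_cons_of_mem _ hy)
    exact (List.nodup_cons.1 h'.nodup).1 (this ▸ hy)
  · simp [List.head?_append, h.head]
  · have := h'.last
    rw [List.getLast?_append]
    cases r with
    | nil => simpa [h.last] using this
    | cons d r => rw [List.getLast?_cons_cons] at this; simp [this]
  · simp; omega
  · intro x
    have := h.last_mem
    simp only [List.mem_append, List.mem_cons]
    constructor
    · tauto
    · rintro (hx | rfl | hx) <;> tauto

/-- Two internally disjoint paths with the same ends form a cycle. -/
theorem exists_cycle_of_two_paths (h : IsPathList G a b P) (h' : IsPathList G a b Q)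
    (hne : a ≠ b) (hd : ∀ x ∈ P, x ∈ Q → x = a ∨ x = b) :
    ∃ l, IsCycleList G l ∧ P.length ≤ l.length := by
  obtain ⟨r, rfl⟩ : ∃ r, Q = a :: r := List.head?_eq_some_iff.1 h'.head
  obtain ⟨m, rfl⟩ : ∃ m, r = m ++ [b] := by
    have := h'.last
    rw [List.getLast?_cons] at this
    have h2 : r.getLast? = some b := by
      cases hr : r.getLast? with
      | none => simp [hr] at this; exact absurd this hne
      | some d => simpa [hr] using this
    exact List.getLast?_eq_some_iff.1 h2
  have hc := h'.chain
  have hn := h'.nodup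
  rcases List.eq_nil_or_concat m with rfl | ⟨m', d, hm⟩
  · simp only [List.nil_append, List.isChain_cons_cons] at hc
    exact ⟨P, ⟨a, b, h, hc.1.symm⟩, le_rfl⟩
  · obtain ⟨e, m'', hm2⟩ : ∃ e m'', m = e :: m'' := by
      cases m with
      | nil => simp at hm
      | cons e m'' => exact ⟨e, m'', rfl⟩
    have hpm : IsPathList G e d m := by
      refine ⟨?_, ?_, by simp [hm2], by simp [hm]⟩
      · exact (List.isChain_append.1 (List.isChain_cons.1 hc).2).1
      · exact (List.nodup_append.1 (List.nodup_cons.1 hn).2).1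
    have hdb : G.Adj d b := by
      have := (List.isChain_append.1 (List.isChain_cons.1 hc).2).2.2
      exact this d hpm.last b (by simp)
    have hae : G.Adj a e := (List.isChain_cons.1 hc).1 e (by simp [hm2])
    refine ⟨P ++ m.reverse, (h.append hpm.reverse hdb.symm ?_).isCycleList hae.symm, by simp⟩
    intro x hx hx'
    have hx2 : x ∈ m := List.mem_reverse.1 hx'
    rcases hd x hx (by simp [hx2]) with rfl | rfl
    · exact (List.nodup_cons.1 hn).1 (by simp [hx2])
    · exact (List.nodup_append.1 (List.nodup_cons.1 hn).2).2.2 x hx2 x (by simp) rfl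

theorem NoCutVertex.exists_path {W : Set V} (hW : NoCutVertex G W) {w : V} {U T : Set V}
    (hU : U ⊆ W) (hT : T ⊆ W) (hUne : U.Nonempty) (hTne : T.Nonempty) (hwU : w ∉ U)
    (hwT : w ∉ T) :
    ∃ z ∈ U, ∃ t ∈ T, ∃ l, IsPathList G z t l ∧ w ∉ l ∧ (∀ x ∈ l, x ∈ W) ∧
      (∀ x ∈ l, x ∈ U → x = z) ∧ ∀ x ∈ l, x ∈ T → x = t := by
  classical
  have hex : ∃ n, ∃ z ∈ U, ∃ t ∈ T, ∃ l, IsPathList G z t l ∧ w ∉ l ∧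
      (∀ x ∈ l, x ∈ W) ∧ l.length = n := by
    by_contra! hno
    let S : Set V := {x | ∃ z ∈ U, ∃ l, IsPathList G z x l ∧ w ∉ l ∧ ∀ x ∈ l, x ∈ W}
    have hUS : U ⊆ S := fun z hz => ⟨z, hz, [z], .single z, by
      rintro h; simp at h; exact hwU (h ▸ hz), by simpa using hU hz⟩
    have hTS : ∀ t ∈ T, t ∉ S := by
      rintro t ht ⟨z, hz, l, hl, hw, hlW⟩
      exact hno l.length z hz t ht l hl hw hlW rfl
    have hwS : w ∉ S := by
      rintro ⟨z, hz, l, hl, hw, -⟩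
      exact hw hl.last_mem
    obtain ⟨t, ht⟩ := hTne
    obtain ⟨a, ⟨z, hz, l, hl, hw, hlW⟩, b, hbW, hbS, hbw, hab⟩ := hW w S
      (by rintro x ⟨z, hz, l, hl, hw, hlW⟩; exact hlW x hl.last_mem)
      (hUne.mono hUS) hwS ⟨t, hT ht, hTS t ht, fun h => hwT (h ▸ ht)⟩
    by_cases hbl : b ∈ l
    · obtain ⟨P, hP, hPl, -⟩ := hl.exists_prefix hbl
      exact hbS ⟨z, hz, P, hP, fun h => hw (hPl _ h), fun x hx => hlW x (hPl x hx)⟩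
    · refine hbS ⟨z, hz, _, hl.concat hab hbl, by simp [hw, hbw.symm], fun x hx => ?_⟩
      simp only [List.mem_append, List.mem_singleton] at hx
      rcases hx with hx | rfl
      · exact hlW x hx
      · exact hbW
  obtain ⟨z, hz, t, ht, l, hl, hw, hlW, hlen⟩ := Nat.find_spec hex
  refine ⟨z, hz, t, ht, l, hl, hw, hlW, fun x hx hxU => ?_, fun x hx hxT => ?_⟩
  · by_contra hne
    obtain ⟨P, hP, hPl, hlt⟩ := hl.exists_suffix hx
    exact Nat.find_min hex (hlen ▸ hlt hne)
      ⟨x, hxU, t, ht, P, hP, fun h => hw (hPl _ h), fun x hx => hlW x (hPl x hx), rfl⟩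
  · by_contra hne
    obtain ⟨P, hP, hPl, -, -, hlt⟩ := hl.exists_prefix hx
    exact Nat.find_min hex (hlen ▸ hlt hne)
      ⟨z, hz, x, hxT, P, hP, fun h => hw (hPl _ h), fun x hx => hlW x (hPl x hx), rfl⟩

/-- Two disjoint paths from `{v 0, …, v i₀}` to `{v i, …, v L}`, the first ending in `v i`, the
second in `t`, one of them starting in `v i₀`. -/
structure IsLinkage (G : SimpleGraph V) (v : ℕ → V) (L i₀ i : ℕ) (a₁ a₂ t : V)
    (Q₁ Q₂ : List V) : Prop where
  path₁ : IsPathList G a₁ (v i) Q₁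
  path₂ : IsPathList G a₂ t Q₂
  disj : ∀ x ∈ Q₁, x ∉ Q₂
  start₁ : ∃ k ≤ i₀, v k = a₁
  start₂ : ∃ k ≤ i₀, v k = a₂
  start : v i₀ = a₁ ∨ v i₀ = a₂
  only₁ : ∀ k ≤ i₀, v k ∈ Q₁ → v k = a₁
  only₂ : ∀ k ≤ i₀, v k ∈ Q₂ → v k = a₂
  target : ∃ k, i < k ∧ k ≤ L ∧ v k = t
  end₁ : ∀ k, i < k → k ≤ L → v k ∉ Q₁
  end₂ : ∀ k, i ≤ k → k ≤ L → v k ∈ Q₂ → v k = t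

theorem exists_isLinkage {W : Set V} (hW : NoCutVertex G W) {v : ℕ → V} {L i₀ : ℕ}
    (hv : IsPathFun G v L) (hvW : ∀ k ≤ L, v k ∈ W) (hi₀ : 0 < i₀) (n : ℕ) (hn : i₀ + n < L) :
    ∃ a₁ a₂ t Q₁ Q₂, IsLinkage G v L i₀ (i₀ + n) a₁ a₂ t Q₁ Q₂ := by
  induction n with
  | zero =>
    obtain ⟨z, ⟨k, hk, rfl⟩, t, ⟨j, hj, hjL, rfl⟩, l, hl, hw, hlW, hlU, hlT⟩ :=
      hW.exists_path (w := v i₀) (U := {x | ∃ k < i₀, v k = x})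
        (T := {x | ∃ k, i₀ < k ∧ k ≤ L ∧ v k = x})
        (by rintro _ ⟨k, hk, rfl⟩; exact hvW k (by omega))
        (by rintro _ ⟨k, hk, hkL, rfl⟩; exact hvW k hkL) ⟨v 0, 0, hi₀, rfl⟩
        ⟨v L, L, by omega, le_rfl, rfl⟩
        (by rintro ⟨k, hk, h⟩; have := hv.inj _ (by omega) _ (by omega) h; omega)
        (by rintro ⟨k, hk, hkL, h⟩; have := hv.inj _ (by omega) _ (by omega) h; omega)
    refine ⟨v i₀, v k, v j, [v i₀], l, .single _, hl, ?_, ⟨i₀, le_rfl, rfl⟩, ⟨k, hk.le, rfl⟩,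
      .inl rfl, ?_, ?_, ⟨j, hj, hjL, rfl⟩, ?_, ?_⟩
    · simpa using hw
    · simp
    · intro i hi hil
      rcases hi.lt_or_eq with h | rfl
      · exact hlU _ hil ⟨i, h, rfl⟩
      · exact absurd hil hw
    · intro i hi hiL h
      simp only [List.mem_singleton] at h
      have := hv.inj _ (by omega) _ (by omega) h
      omega
    · intro i hi hiL h
      rcases hi.lt_or_eq with h' | rfl
      · exact hlT _ h ⟨i, h', hiL, rfl⟩
      · exact absurd h hw
  | succ n ih =>
    obtain ⟨a₁, a₂, t, Q₁, Q₂, h⟩ := ih (by omega)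
    rw [← add_assoc]
    set i := i₀ + n with hi
    have hadj := hv.adj i (by omega)
    have hq₁ : v (i + 1) ∉ Q₁ := h.end₁ _ (by omega) (by omega)
    have hqA : ∀ k ≤ i₀, v k ≠ v (i + 1) := fun k hk he => by
      have := hv.inj _ (by omega) _ (by omega) he
      omega
    -- extending the first path by the next vertex of the base path
    have hext : IsPathList G a₁ (v (i + 1)) (Q₁ ++ [v (i + 1)]) := h.path₁.concat hadj hq₁
    have hext_only : ∀ k ≤ i₀, v k ∈ Q₁ ++ [v (i + 1)] → v k = a₁ := by
      intro k hk hm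
      simp only [List.mem_append, List.mem_singleton] at hm
      exact h.only₁ k hk (hm.resolve_right (hqA k hk))
    have hext_end : ∀ k, i + 1 < k → k ≤ L → v k ∉ Q₁ ++ [v (i + 1)] := by
      intro k hk hkL hm
      simp only [List.mem_append, List.mem_singleton] at hm
      rcases hm with hm | hm
      · exact h.end₁ k (by omega) hkL hm
      · have := hv.inj _ (by omega) _ (by omega) hm
        omega
    by_cases ht : t = v (i + 1)
    · subst ht
      have hQ₂end : ∀ k, i + 1 < k → k ≤ L → v k ∉ Q₂ := by
        intro k hk hkL hm
        have := hv.inj _ (by omega) _ (by omega) (h.end₂ k (by omega) hkL hm)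
        omega
      obtain ⟨z, ⟨⟨hzW, hz⟩, hzq⟩, _, ⟨j, hj, hjL, rfl⟩, l, hl, hw, hlW, hlU, hlT⟩ :=
        hW.exists_path (w := v (i + 1))
          (U := {x | (x ∈ W ∧ ((∃ k ≤ i₀, v k = x) ∨ x ∈ Q₁ ∨ x ∈ Q₂)) ∧ x ≠ v (i + 1)})
          (T := {x | ∃ k, i + 1 < k ∧ k ≤ L ∧ v k = x})
          (fun x hx => hx.1.1)
          (by rintro _ ⟨k, hk, hkL, rfl⟩; exact hvW k hkL)
          ⟨v 0, ⟨hvW 0 (by omega), .inl ⟨0, by omega, rfl⟩⟩, hqA 0 (by omega)⟩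
          ⟨v L, L, by omega, le_rfl, rfl⟩
          (fun h => h.2 rfl)
          (by rintro ⟨k, hk, hkL, h⟩; have := hv.inj _ (by omega) _ (by omega) h; omega)
      have hlA : ∀ k ≤ i₀, v k ∈ l → v k = z := fun k hk hm =>
        hlU _ hm ⟨⟨hlW _ hm, .inl ⟨k, hk, rfl⟩⟩, hqA k hk⟩
      have hlQ₁ : ∀ x ∈ l, x ∈ Q₁ → x = z := fun x hx hm =>
        hlU _ hx ⟨⟨hlW _ hx, .inr (.inl hm)⟩, fun e => hq₁ (e ▸ hm)⟩
      have hlQ₂ : ∀ x ∈ l, x ∈ Q₂ → x = z := fun x hx hm =>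
        hlU _ hx ⟨⟨hlW _ hx, .inr (.inr hm)⟩, fun e => hw (e ▸ hx)⟩
      have hl_end : ∀ k, i + 1 ≤ k → k ≤ L → v k ∈ l → v k = v j := by
        intro k hk hkL hm
        rcases hk.lt_or_eq with hk | rfl
        · exact hlT _ hm ⟨k, hk, hkL, rfl⟩
        · exact absurd hm hw
      by_cases hz₁ : z ∈ Q₁
      · obtain ⟨P, hP, hPQ, -⟩ := h.path₁.exists_prefix hz₁
        obtain ⟨R, hR, -, hRmem⟩ := hP.glue hl fun x hx hx' => hlQ₁ x hx' (hPQ x hx)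
        refine ⟨_, _, _, _, _, h.path₂, hR, ?_, h.start₂, h.start₁, h.start.symm, h.only₂, ?_,
          ⟨j, hj, hjL, rfl⟩, hQ₂end, ?_⟩
        · intro x hx hx'
          rcases (hRmem x).1 hx' with hx' | hx'
          · exact h.disj x (hPQ x hx') hx
          · obtain rfl := hlQ₂ x hx' hx
            exact h.disj x hz₁ hx
        · intro k hk hm
          rcases (hRmem _).1 hm with hm | hm
          · exact h.only₁ k hk (hPQ _ hm)
          · have := hlA k hk hm
            exact h.only₁ k hk (this ▸ hz₁)
        · intro k hk hkL hm
          rcases (hRmem _).1 hm with hm | hm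
          · exact absurd (hPQ _ hm) (h.end₁ k (by omega) hkL)
          · exact hl_end k hk hkL hm
      · by_cases hz₂ : z ∈ Q₂
        · obtain ⟨P, hP, hPQ, hPq, -⟩ := h.path₂.exists_prefix hz₂
          have hqP : v (i + 1) ∉ P := fun hm => hzq (hPq hm).symm
          obtain ⟨R, hR, -, hRmem⟩ := hP.glue hl fun x hx hx' => hlQ₂ x hx' (hPQ x hx)
          refine ⟨_, _, _, _, _, hext, hR, ?_, h.start₁, h.start₂, h.start, hext_only, ?_,
            ⟨j, hj, hjL, rfl⟩, hext_end, ?_⟩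
          · intro x hx hx'
            simp only [List.mem_append, List.mem_singleton] at hx
            rcases (hRmem x).1 hx' with hx' | hx'
            · rcases hx with hx | rfl
              · exact h.disj x hx (hPQ x hx')
              · exact hqP hx'
            · rcases hx with hx | rfl
              · exact hz₁ (hlQ₁ x hx' hx ▸ hx)
              · exact hw hx'
          · intro k hk hm
            rcases (hRmem _).1 hm with hm | hm
            · exact h.only₂ k hk (hPQ _ hm)
            · have := hlA k hk hm
              exact h.only₂ k hk (this ▸ hz₂)
          · intro k hk hkL hm
            rcases (hRmem _).1 hm with hm | hm
            · rcases hk.lt_or_eq with hk | rfl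
              · exact absurd (hPQ _ hm) (hQ₂end k hk hkL)
              · exact absurd hm hqP
            · exact hl_end k hk hkL hm
        · obtain ⟨k₀, hk₀, rfl⟩ : ∃ k ≤ i₀, v k = z := by tauto
          rcases h.start with hs | hs
          · refine ⟨_, _, _, _, _, hext, hl, ?_, h.start₁, ⟨k₀, hk₀, rfl⟩, .inl hs, hext_only, hlA,
              ⟨j, hj, hjL, rfl⟩, hext_end, hl_end⟩
            intro x hx hx'
            simp only [List.mem_append, List.mem_singleton] at hx
            rcases hx with hx | rfl
            · exact hz₁ (hlQ₁ x hx' hx ▸ hx)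
            · exact hw hx'
          · refine ⟨_, _, _, _, _, h.path₂, hl, ?_, h.start₂, ⟨k₀, hk₀, rfl⟩, .inl hs, h.only₂, hlA,
              ⟨j, hj, hjL, rfl⟩, hQ₂end, hl_end⟩
            intro x hx hx'
            exact hz₂ (hlQ₂ x hx' hx ▸ hx)
    · refine ⟨_, _, _, _, _, hext, h.path₂, ?_, h.start₁, h.start₂, h.start, hext_only, h.only₂,
        ?_, hext_end, fun k hk => h.end₂ k (by omega)⟩
      · intro x hx hx'
        simp only [List.mem_append, List.mem_singleton] at hx
        rcases hx with hx | rfl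
        · exact h.disj x hx hx'
        · exact ht (h.end₂ _ (by omega) (by omega) hx').symm
      · obtain ⟨k, hk, hkL, rfl⟩ := h.target
        refine ⟨k, ?_, hkL, rfl⟩
        by_contra hk'
        obtain rfl : k = i + 1 := by omega
        exact ht rfl

end Linkage

section Posa

variable {V : Type*} {G : SimpleGraph V} {X Y : Finset V} {v : ℕ → V} {L : ℕ}

theorem IsPathFun.odd_add_of_adj (hb : G.IsBipartiteWith X Y) (hv : IsPathFun G v L) {i j : ℕ}
    (hi : i ≤ L) (hj : j ≤ L) (hij : G.Adj (v i) (v j)) : Odd (i + j) := by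
  have hne : i ≠ j := by rintro rfl; exact hij.ne rfl
  have key : ∀ {X Y : Finset V}, G.IsBipartiteWith X Y → v 0 ∈ X → Odd (i + j) := by
    intro X Y hb h0
    have hpar := hv.mem_of_even hb h0
    rcases Nat.even_or_odd' i with ⟨a, rfl | rfl⟩ <;> rcases Nat.even_or_odd' j with ⟨b, rfl | rfl⟩
    · exact absurd rfl (ne_of_mem hb ((hpar b).1 hj) (mem_right hb ((hpar a).1 hi) hij))
    · exact ⟨a + b, by ring⟩
    · exact ⟨a + b, by ring⟩
    · exact absurd rfl (ne_of_mem hb (mem_left hb ((hpar a).2 hi) hij) ((hpar b).2 hj))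
  rcases hb.mem_of_adj (hv.adj 0 (by omega)) with h | h
  · exact key hb h.1
  · exact key hb.symm h.1

theorem IsPathFun.reverse (hv : IsPathFun G v L) : IsPathFun G (fun k => v (L - k)) L := by
  refine ⟨fun i hi => ?_, fun i hi j hj h => ?_⟩
  · have := hv.adj (L - (i + 1)) (by omega)
    rw [show L - (i + 1) + 1 = L - i by omega] at this
    exact this.symm
  · have := hv.inj _ (by omega) _ (by omega) h
    omega

/-- If all neighbours of `v 0` among a set `K` of odd positions lie up to `i₀ ∈ K`, then every
earlier vertex is joined to `v i₀` by a long path inside the initial segment. -/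
theorem exists_left_arc (hv : IsPathFun G v L) {K : Finset ℕ} {i₀ a : ℕ}
    (hK : ∀ k ∈ K, Odd k ∧ G.Adj (v 0) (v k)) (hi₀ : i₀ ∈ K) (hmax : ∀ k ∈ K, k ≤ i₀)
    (hL : i₀ ≤ L) (ha : a < i₀) :
    ∃ P, IsPathList G (v a) (v i₀) P ∧ (∀ x ∈ P, ∃ k ≤ i₀, v k = x) ∧ 2 * #K ≤ P.length + 1 := by
  have hex : ∃ k, k ∈ K ∧ a < k := ⟨i₀, hi₀, ha⟩
  obtain ⟨hkK, hak⟩ := Nat.find_spec hex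
  have hmin : ∀ k' ∈ K, a < k' → Nat.find hex ≤ k' := fun k' h1 h2 => Nat.find_min' hex ⟨h1, h2⟩
  set k := Nat.find hex
  have hki := hmax k hkK
  refine ⟨(segment v 0 a).reverse ++ segment v k i₀,
    (hv.segment (by omega) (by omega)).reverse.append (hv.segment hki hL) (hK k hkK).2 ?_, ?_, ?_⟩
  · intro x hx
    exact hv.disjoint_segment (by omega) hL (by omega) x (List.mem_reverse.1 hx)
  · intro x hx
    simp only [List.mem_append, List.mem_reverse, mem_segment] at hx
    rcases hx with ⟨i, _, hi, rfl⟩ | ⟨i, _, hi, rfl⟩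
    · exact ⟨i, by omega, rfl⟩
    · exact ⟨i, hi, rfl⟩
  · have hinj : Set.InjOn (fun x => x / 2) (K : Set ℕ) := by
      intro x hx y hy hxy
      obtain ⟨p, rfl⟩ := (hK x hx).1
      obtain ⟨q, rfl⟩ := (hK y hy).1
      simp only at hxy
      omega
    have hsub : K.image (fun x => x / 2) ⊆ range ((a + 1) / 2) ∪ Icc (k / 2) (i₀ / 2) := by
      intro z hz
      obtain ⟨x, hx, rfl⟩ := mem_image.1 hz
      have h1 := hmax x hx
      obtain ⟨p, hp⟩ := (hK x hx).1
      simp only [mem_union, mem_range, mem_Icc]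
      rcases le_or_gt x a with h | h
      · left; omega
      · have := hmin x hx h
        right; omega
    have h1 := (card_le_card hsub).trans (card_union_le _ _)
    rw [card_image_of_injOn hinj, card_range, Nat.card_Icc] at h1
    obtain ⟨p, hp⟩ := (hK k hkK).1
    obtain ⟨q, hq⟩ := (hK i₀ hi₀).1
    simp only [List.length_append, List.length_reverse, length_segment]
    omega

theorem exists_cycle_of_crossing {s : ℕ} (hv : IsPathFun G v L) {K J : Finset ℕ}
    (hK : ∀ k ∈ K, k ≤ L ∧ Odd k ∧ G.Adj (v 0) (v k))
    (hJ : ∀ j ∈ J, j ≤ L ∧ Odd (L + j) ∧ G.Adj (v L) (v j)) (hL : 2 * s + 1 ≤ L)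
    (hodd : Odd L → s + 2 ≤ #K + #J) (heven : Even L → s + 3 ≤ #K + #J)
    (hcross : ∃ j ∈ J, ∃ k ∈ K, j < k) : ∃ l, IsCycleList G l ∧ 2 * s + 2 ≤ l.length := by
  have hex : ∃ g, ∃ j ∈ J, ∃ k ∈ K, j < k ∧ k = j + g := by
    obtain ⟨j, hj, k, hk, hjk⟩ := hcross
    exact ⟨k - j, j, hj, k, hk, hjk, by omega⟩
  obtain ⟨j, hj, k, hk, hjk, hkg⟩ := Nat.find_spec hex
  have hmin : ∀ j' ∈ J, ∀ k' ∈ K, j' < k' → j' + Nat.find hex ≤ k' := by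
    intro j' hj' k' hk' h
    have := Nat.find_min' hex ⟨j', hj', k', hk', h, (Nat.add_sub_cancel' h.le).symm⟩
    omega
  set g := Nat.find hex
  obtain ⟨hjL, hjo, hjadj⟩ := hJ j hj
  obtain ⟨hkL, hko, hkadj⟩ := hK k hk
  refine ⟨segment v 0 j ++ (segment v k L).reverse, ((hv.segment (by omega) hjL).append
    (hv.segment hkL le_rfl).reverse hjadj.symm ?_).isCycleList hkadj.symm, ?_⟩
  · intro x hx hx'
    exact hv.disjoint_segment hjL le_rfl (by omega) x hx (List.mem_reverse.1 hx')
  simp only [List.length_append, List.length_reverse, length_segment]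
  have hKgap : ∀ k' ∈ K, k' ≤ j ∨ k ≤ k' := fun k' hk' => by
    by_contra! h
    have := hmin j hj k' hk' h.1
    omega
  have hJgap : ∀ j' ∈ J, j' ≤ j ∨ k ≤ j' := fun j' hj' => by
    by_contra! h
    have := hmin j' hj' k hk h.2
    omega
  obtain ⟨k₁, rfl⟩ := hko
  rcases Nat.even_or_odd' L with ⟨L₁, rfl | rfl⟩
  · -- both ends of the path on the same side
    have hjo' : ∃ j₁, j = 2 * j₁ + 1 := by obtain ⟨p, hp⟩ := hjo; exact ⟨p - L₁, by omega⟩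
    obtain ⟨j₁, rfl⟩ := hjo'
    by_cases hg : g ≤ 2
    · omega
    set K' := (K.erase (2 * k₁ + 1)).erase 1 with hK'
    have hcK : #K ≤ #K' + 2 := by
      have h1 := pred_card_le_card_erase (s := K) (a := 2 * k₁ + 1)
      have h2 := pred_card_le_card_erase (s := K.erase (2 * k₁ + 1)) (a := 1)
      rw [hK']
      omega
    have hmem : ∀ x ∈ K', x ∈ K ∧ x ≠ 1 ∧ x ≠ 2 * k₁ + 1 ∧ ∃ p, x = 2 * p + 3 := by
      intro x hx
      simp only [hK', mem_erase] at hx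
      obtain ⟨p, hp⟩ := (hK x hx.2.2).2.1
      exact ⟨hx.2.2, hx.1, hx.2.1, p - 1, by omega⟩
    have hJmem : ∀ x ∈ J, ∃ p, x = 2 * p + 1 := by
      intro x hx
      obtain ⟨p, hp⟩ := (hJ x hx).2.1
      exact ⟨p - L₁, by omega⟩
    have hi1 : Set.InjOn (fun x => (x - 3) / 2) (K' : Set ℕ) := by
      intro x hx y hy hxy
      obtain ⟨-, -, -, p, rfl⟩ := hmem x hx
      obtain ⟨-, -, -, q, rfl⟩ := hmem y hy
      simp only at hxy
      omega
    have hi2 : Set.InjOn (fun x => x / 2) (J : Set ℕ) := by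
      intro x hx y hy hxy
      obtain ⟨p, rfl⟩ := hJmem x hx
      obtain ⟨q, rfl⟩ := hJmem y hy
      simp only at hxy
      omega
    have hdisj : Disjoint (K'.image fun x => (x - 3) / 2) (J.image fun x => x / 2) := by
      rw [disjoint_left]
      intro z hz hz'
      obtain ⟨x, hx, rfl⟩ := mem_image.1 hz
      obtain ⟨y, hy, hxy⟩ := mem_image.1 hz'
      obtain ⟨h1, -, -, p, rfl⟩ := hmem x hx
      obtain ⟨q, rfl⟩ := hJmem y hy
      have := hmin _ hy _ h1 (by omega)
      omega
    have hsub : (K'.image fun x => (x - 3) / 2) ∪ (J.image fun x => x / 2) ⊆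
        range (j₁ + 1) ∪ Ico k₁ L₁ := by
      intro z hz
      simp only [mem_union, mem_image, mem_range, mem_Ico] at hz ⊢
      rcases hz with ⟨x, hx, rfl⟩ | ⟨x, hx, rfl⟩
      · obtain ⟨h1, -, h3, p, rfl⟩ := hmem x hx
        have := hKgap _ h1
        have := (hK _ h1).1
        omega
      · obtain ⟨q, rfl⟩ := hJmem x hx
        have := hJgap _ hx
        have := (hJ _ hx).1
        omega
    have h1 := (card_le_card hsub).trans (card_union_le _ _)
    rw [card_union_of_disjoint hdisj, card_image_of_injOn hi1, card_image_of_injOn hi2, card_range,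
      Nat.card_Ico] at h1
    have := heven ⟨L₁, by ring⟩
    omega
  · have hjo' : ∃ j₁, j = 2 * j₁ := by obtain ⟨p, hp⟩ := hjo; exact ⟨p - L₁, by omega⟩
    obtain ⟨j₁, rfl⟩ := hjo'
    by_cases hg : g ≤ 1
    · omega
    have hJmem : ∀ x ∈ J, ∃ p, x = 2 * p := by
      intro x hx
      obtain ⟨p, hp⟩ := (hJ x hx).2.1
      exact ⟨p - L₁, by omega⟩
    have hi1 : Set.InjOn (fun x => x / 2) (K : Set ℕ) := by
      intro x hx y hy hxy
      obtain ⟨p, rfl⟩ := (hK x hx).2.1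
      obtain ⟨q, rfl⟩ := (hK y hy).2.1
      simp only at hxy
      omega
    have hi2 : Set.InjOn (fun x => x / 2) (J : Set ℕ) := by
      intro x hx y hy hxy
      obtain ⟨p, rfl⟩ := hJmem x hx
      obtain ⟨q, rfl⟩ := hJmem y hy
      simp only at hxy
      omega
    have hdisj : Disjoint (K.image fun x => x / 2) (J.image fun x => x / 2) := by
      rw [disjoint_left]
      intro z hz hz'
      obtain ⟨x, hx, rfl⟩ := mem_image.1 hz
      obtain ⟨y, hy, hxy⟩ := mem_image.1 hz'
      obtain ⟨p, rfl⟩ := (hK x hx).2.1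
      obtain ⟨q, rfl⟩ := hJmem y hy
      have := hmin _ hy _ hx (by omega)
      omega
    have hsub : (K.image fun x => x / 2) ∪ (J.image fun x => x / 2) ⊆
        range (j₁ + 1) ∪ Icc k₁ L₁ := by
      intro z hz
      simp only [mem_union, mem_image, mem_range, mem_Icc] at hz ⊢
      rcases hz with ⟨x, hx, rfl⟩ | ⟨x, hx, rfl⟩
      · obtain ⟨p, rfl⟩ := (hK x hx).2.1
        have := hKgap _ hx
        have := (hK _ hx).1
        omega
      · obtain ⟨q, rfl⟩ := hJmem x hx
        have := hJgap _ hx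
        have := (hJ _ hx).1
        omega
    have h1 := (card_le_card hsub).trans (card_union_le _ _)
    rw [card_union_of_disjoint hdisj, card_image_of_injOn hi1, card_image_of_injOn hi2, card_range,
      Nat.card_Icc] at h1
    have := hodd ⟨L₁, by ring⟩
    omega

theorem exists_cycle_of_not_crossing {s : ℕ} {W : Set V} (hW : NoCutVertex G W)
    (hv : IsPathFun G v L) (hvW : ∀ k ≤ L, v k ∈ W) {K J : Finset ℕ}
    (hK : ∀ k ∈ K, k ≤ L ∧ Odd k ∧ G.Adj (v 0) (v k))
    (hJ : ∀ j ∈ J, j ≤ L ∧ Odd (L + j) ∧ G.Adj (v L) (v j))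
    (hKne : K.Nonempty) (hJne : J.Nonempty)
    (hodd : Odd L → s + 2 ≤ #K + #J) (heven : Even L → s + 3 ≤ #K + #J)
    (hcross : ∀ j ∈ J, ∀ k ∈ K, k ≤ j) : ∃ l, IsCycleList G l ∧ 2 * s + 2 ≤ l.length := by
  obtain ⟨i₀, hi₀, hmax⟩ : ∃ i₀ ∈ K, ∀ k ∈ K, k ≤ i₀ :=
    ⟨K.max' hKne, K.max'_mem hKne, fun k hk => K.le_max' k hk⟩
  obtain ⟨j₀, hj₀, hmin⟩ : ∃ j₀ ∈ J, ∀ j ∈ J, j₀ ≤ j :=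
    ⟨J.min' hJne, J.min'_mem hJne, fun j hj => J.min'_le j hj⟩
  have hij := hcross j₀ hj₀ i₀ hi₀
  obtain ⟨hiL, hio, -⟩ := hK i₀ hi₀
  obtain ⟨hjL, hjo, hjadj⟩ := hJ j₀ hj₀
  have hi0 : 0 < i₀ := hio.pos
  have hjL' : j₀ < L := by
    rcases hjL.lt_or_eq with h | h
    · exact h
    · exact absurd (h ▸ hjadj) (G.irrefl)
  have hleft : ∀ a < i₀, ∃ P, IsPathList G (v a) (v i₀) P ∧ (∀ x ∈ P, ∃ k ≤ i₀, v k = x) ∧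
      2 * #K ≤ P.length + 1 := fun a ha =>
    exists_left_arc hv (fun k hk => (hK k hk).2) hi₀ hmax hiL ha
  have hright : ∀ b, j₀ < b → b ≤ L → ∃ P, IsPathList G (v j₀) (v b) P ∧
      (∀ x ∈ P, ∃ k, j₀ ≤ k ∧ k ≤ L ∧ v k = x) ∧ 2 * #J ≤ P.length + 1 := by
    intro b hb hbL
    obtain ⟨P, hP, hPm, hPl⟩ := exists_left_arc hv.reverse (K := J.image fun j => L - j)
      (i₀ := L - j₀) (a := L - b) (by
        intro k hk
        obtain ⟨j, hj, rfl⟩ := mem_image.1 hk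
        obtain ⟨h1, ⟨p, hp⟩, h3⟩ := hJ j hj
        refine ⟨⟨p - j, by omega⟩, ?_⟩
        rw [show L - (L - j) = j by omega]
        exact h3) (mem_image_of_mem _ hj₀)
      (by
        intro k hk
        obtain ⟨j, hj, rfl⟩ := mem_image.1 hk
        have := hmin j hj
        omega) (by omega) (by omega)
    simp only [show L - (L - b) = b by omega, show L - (L - j₀) = j₀ by omega] at hP
    refine ⟨P.reverse, hP.reverse, ?_, ?_⟩
    · intro x hx
      obtain ⟨k, hk, rfl⟩ := hPm x (List.mem_reverse.1 hx)
      exact ⟨L - k, by omega, by omega, rfl⟩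
    · rw [card_image_of_injOn] at hPl
      · simpa using hPl
      · intro x hx y hy hxy
        have h1 := (hJ x hx).1
        have h2 := (hJ y hy).1
        simp only at hxy
        omega
  rcases hij.lt_or_eq with hlt | rfl
  · obtain ⟨a₁, a₂, t, Q₁, Q₂, h⟩ :=
      exists_isLinkage hW hv hvW hi0 (j₀ - i₀) (by omega)
    rw [show i₀ + (j₀ - i₀) = j₀ by omega] at h
    obtain ⟨b, hb, hbL, rfl⟩ := h.target
    obtain ⟨R, hR, hRm, hRl⟩ := hright b hb hbL
    have hdisj : ∀ x, (∃ k ≤ i₀, v k = x) → (∃ k, j₀ ≤ k ∧ k ≤ L ∧ v k = x) → False := by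
      rintro _ ⟨k, hk, rfl⟩ ⟨k', hk', hkL', he⟩
      have := hv.inj _ hkL' _ (by omega) he
      omega
    have hne : a₁ ≠ a₂ := fun he => h.disj _ h.path₁.head_mem (he ▸ h.path₂.head_mem)
    -- the second path meets the final segment only in its last vertex, the first one only in `v j₀`
    have hQ₁R : ∀ x ∈ Q₁, (∃ k, j₀ ≤ k ∧ k ≤ L ∧ v k = x) → x = v j₀ := by
      rintro _ hx ⟨k, hk, hkL, rfl⟩
      rcases hk.lt_or_eq with hk | rfl
      · exact absurd hx (h.end₁ k hk hkL)
      · rfl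
    have hQ₂R : ∀ x ∈ Q₂, (∃ k, j₀ ≤ k ∧ k ≤ L ∧ v k = x) → x = v b := by
      rintro _ hx ⟨k, hk, hkL, rfl⟩
      exact h.end₂ k hk hkL hx
    have hQ₁l : ∀ x ∈ Q₁, (∃ k ≤ i₀, v k = x) → x = a₁ := by
      rintro _ hx ⟨k, hk, rfl⟩
      exact h.only₁ k hk hx
    have hQ₂l : ∀ x ∈ Q₂, (∃ k ≤ i₀, v k = x) → x = a₂ := by
      rintro _ hx ⟨k, hk, rfl⟩
      exact h.only₂ k hk hx
    have hlen1 : 2 ≤ Q₁.length := by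
      by_contra hlt
      obtain ⟨z, rfl⟩ : ∃ z, Q₁ = [z] := List.length_eq_one_iff.1 (by
        have := h.path₁.length_pos; omega)
      have h1 := h.path₁.head_mem
      have h2 := h.path₁.last_mem
      simp only [List.mem_singleton] at h1 h2
      exact hdisj _ h.start₁ ⟨j₀, le_rfl, hjL, h2.trans h1.symm⟩
    have hlen2 : 2 ≤ Q₂.length := by
      by_contra hlt
      obtain ⟨z, rfl⟩ : ∃ z, Q₂ = [z] := List.length_eq_one_iff.1 (by
        have := h.path₂.length_pos; omega)
      have h1 := h.path₂.head_mem
      have h2 := h.path₂.last_mem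
      simp only [List.mem_singleton] at h1 h2
      exact hdisj _ h.start₂ ⟨b, hb.le, hbL, h2.trans h1.symm⟩
    have hcard : s + 2 ≤ #K + #J := by
      rcases Nat.even_or_odd L with h | h
      · have := heven h; omega
      · exact hodd h
    rcases h.start with rfl | rfl
    · obtain ⟨a, ha, rfl⟩ := h.start₂
      have ha' : a < i₀ := lt_of_le_of_ne ha (by rintro rfl; exact hne rfl)
      obtain ⟨P, hP, hPm, hPl⟩ := hleft a ha'
      obtain ⟨P₁, hP₁, hP₁l, hP₁m⟩ := hP.glue h.path₁ fun x hx hx' => hQ₁l x hx' (hPm x hx)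
      obtain ⟨P₂, hP₂, hP₂l, hP₂m⟩ := hP₁.glue hR fun x hx hx' => by
        rcases (hP₁m x).1 hx with hx | hx
        · exact (hdisj x (hPm x hx) (hRm x hx')).elim
        · exact hQ₁R x hx (hRm x hx')
      obtain ⟨l, hl, hll⟩ := exists_cycle_of_two_paths hP₂ h.path₂
        (fun he => hdisj _ h.start₂ ⟨b, hb.le, hbL, he.symm⟩) (fun x hx hx' => by
          rcases (hP₂m x).1 hx with hx | hx
          · rcases (hP₁m x).1 hx with hx | hx
            · exact .inl (hQ₂l x hx' (hPm x hx))
            · exact (h.disj x hx hx').elim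
          · exact .inr (hQ₂R x hx' (hRm x hx)))
      exact ⟨l, hl, by omega⟩
    · obtain ⟨a, ha, rfl⟩ := h.start₁
      have ha' : a < i₀ := lt_of_le_of_ne ha (by rintro rfl; exact hne rfl)
      obtain ⟨P, hP, hPm, hPl⟩ := hleft a ha'
      obtain ⟨P₁, hP₁, hP₁l, hP₁m⟩ := hP.glue h.path₂ fun x hx hx' => hQ₂l x hx' (hPm x hx)
      obtain ⟨P₂, hP₂, hP₂l, hP₂m⟩ := hP₁.glue hR.reverse fun x hx hx' => by
        have hx' := hRm x (List.mem_reverse.1 hx')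
        rcases (hP₁m x).1 hx with hx | hx
        · exact (hdisj x (hPm x hx) hx').elim
        · exact hQ₂R x hx hx'
      rw [List.length_reverse] at hP₂l
      obtain ⟨l, hl, hll⟩ := exists_cycle_of_two_paths hP₂ h.path₁
        (fun he => hdisj _ h.start₁ ⟨j₀, le_rfl, hjL, he.symm⟩) (fun x hx hx' => by
          rcases (hP₂m x).1 hx with hx | hx
          · rcases (hP₁m x).1 hx with hx | hx
            · exact .inl (hQ₁l x hx' (hPm x hx))
            · exact (h.disj x hx' hx).elim
          · exact .inr (hQ₁R x hx' (hRm x (List.mem_reverse.1 hx))))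
      exact ⟨l, hl, by omega⟩
  · have hLe : Even L := by
      obtain ⟨p, hp⟩ := hjo
      obtain ⟨q, hq⟩ := hio
      exact ⟨p - q, by omega⟩
    have hcard := heven hLe
    obtain ⟨_, ⟨a, ha, rfl⟩, _, ⟨b, hb, hbL, rfl⟩, Q, hQ, hw, -, hQU, hQT⟩ :=
      hW.exists_path (w := v i₀) (U := {x | ∃ k < i₀, v k = x})
        (T := {x | ∃ k, i₀ < k ∧ k ≤ L ∧ v k = x})
        (by rintro _ ⟨k, hk, rfl⟩; exact hvW k (by omega))
        (by rintro _ ⟨k, hk, hkL, rfl⟩; exact hvW k hkL) ⟨v 0, 0, hi0, rfl⟩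
        ⟨v L, L, by omega, le_rfl, rfl⟩
        (by rintro ⟨k, hk, h⟩; have := hv.inj _ (by omega) _ (by omega) h; omega)
        (by rintro ⟨k, hk, hkL, h⟩; have := hv.inj _ (by omega) _ (by omega) h; omega)
    obtain ⟨P, hP, hPm, hPl⟩ := hleft a ha
    obtain ⟨R, hR, hRm, hRl⟩ := hright b hb hbL
    obtain ⟨P₁, hP₁, hP₁l, hP₁m⟩ := hP.glue hR fun x hx hx' => by
      obtain ⟨k, hk, rfl⟩ := hPm x hx
      obtain ⟨k', hk', hkL', he⟩ := hRm _ hx'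
      have := hv.inj _ hkL' _ (by omega) he
      rw [show k = i₀ by omega]
    obtain ⟨l, hl, hll⟩ := exists_cycle_of_two_paths hP₁ hQ
      (fun he => by have := hv.inj _ (by omega) _ hbL he; omega) (fun x hx hx' => by
        rcases (hP₁m x).1 hx with hx | hx
        · obtain ⟨k, hk, rfl⟩ := hPm x hx
          rcases hk.lt_or_eq with hk | rfl
          · exact .inl (hQU _ hx' ⟨k, hk, rfl⟩)
          · exact absurd hx' hw
        · obtain ⟨k, hk, hkL, rfl⟩ := hRm x hx
          rcases hk.lt_or_eq with hk | rfl
          · exact .inr (hQT _ hx' ⟨k, hk, hkL, rfl⟩)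
          · exact absurd hx' hw)
    exact ⟨l, hl, by omega⟩

open scoped Classical in
/-- The positions of the neighbours of `x` on `v 0, …, v L`. -/
noncomputable def nbrIndices (G : SimpleGraph V) (v : ℕ → V) (L : ℕ) (x : V) : Finset ℕ :=
  {k ∈ range (L + 1) | G.Adj x (v k)}

/-- A Pósa-type lemma for graphs without cut vertices. -/
theorem exists_cycle_of_path {s : ℕ} {W : Set V} (hb : G.IsBipartiteWith X Y)
    (hW : NoCutVertex G W) (hv : IsPathFun G v L) (hvW : ∀ k ≤ L, v k ∈ W) (hL : 2 * s + 1 ≤ L)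
    (hodd : Odd L → s + 2 ≤ #(nbrIndices G v L (v 0)) + #(nbrIndices G v L (v L)))
    (heven : Even L → s + 3 ≤ #(nbrIndices G v L (v 0)) + #(nbrIndices G v L (v L))) :
    ∃ l, IsCycleList G l ∧ 2 * s + 2 ≤ l.length := by
  have hK : ∀ k ∈ nbrIndices G v L (v 0), k ≤ L ∧ Odd k ∧ G.Adj (v 0) (v k) := by
    intro k hk
    simp only [nbrIndices, mem_filter, mem_range] at hk
    have := hv.odd_add_of_adj hb (by omega) (by omega) hk.2
    exact ⟨by omega, by simpa using this, hk.2⟩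
  have hJ : ∀ j ∈ nbrIndices G v L (v L), j ≤ L ∧ Odd (L + j) ∧ G.Adj (v L) (v j) := by
    intro j hj
    simp only [nbrIndices, mem_filter, mem_range] at hj
    exact ⟨by omega, hv.odd_add_of_adj hb le_rfl (by omega) hj.2, hj.2⟩
  by_cases hc : ∃ j ∈ nbrIndices G v L (v L), ∃ k ∈ nbrIndices G v L (v 0), j < k
  · exact exists_cycle_of_crossing hv hK hJ hL hodd heven hc
  · push Not at hc
    refine exists_cycle_of_not_crossing hW hv hvW hK hJ ⟨1, ?_⟩ ⟨L - 1, ?_⟩ hodd heven hc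
    · simpa [nbrIndices] using ⟨by omega, hv.adj 0 (by omega)⟩
    · have := hv.adj (L - 1) (by omega)
      rw [show L - 1 + 1 = L by omega] at this
      simpa [nbrIndices] using this.symm

end Posa

/-- Any two nonadjacent vertices `x ∈ X` and `y ∈ Y` are joined by a path with at least `2 * s + 2`
vertices. -/
def IsSaturated {V : Type*} (G : SimpleGraph V) (X Y : Finset V) (s : ℕ) : Prop :=
  ∀ x ∈ X, ∀ y ∈ Y, ¬ G.Adj x y → ∃ l, IsPathList G x y l ∧ 2 * s + 2 ≤ l.length

section Saturated

variable {V : Type*} {G H : SimpleGraph V} {X Y : Finset V} {s : ℕ}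

theorem IsPathList.of_forall_mem {a b : V} {l : List V} (h : IsPathList H a b l)
    (hG : ∀ p ∈ l, ∀ q ∈ l, H.Adj p q → G.Adj p q) : IsPathList G a b l := by
  refine ⟨?_, h.nodup, h.head, h.last⟩
  rw [List.isChain_iff_getElem]
  intro i hi
  exact hG _ (List.getElem_mem _) _ (List.getElem_mem _) (List.isChain_iff_getElem.1 h.chain i hi)

/-- A cycle using an additional edge `xy` yields a path from `x` to `y`. -/
theorem exists_path_of_cycle_sup_edge {x y : V} {l : List V} (hl : IsCycleList H l)
    (hH : ∀ p q, H.Adj p q → ¬ G.Adj p q → p = x ∧ q = y ∨ p = y ∧ q = x)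
    (hlen : 3 ≤ l.length) :
    (∃ l', IsCycleList G l' ∧ l'.length = l.length) ∨
      ∃ l', IsPathList G x y l' ∧ l'.length = l.length := by
  obtain ⟨a, b, hp, hba⟩ := hl
  have key : (∃ l', IsCycleList G l' ∧ l'.length = l.length) ∨ ∃ p q l', H.Adj p q ∧
      ¬ G.Adj p q ∧ IsPathList G p q l' ∧ l'.length = l.length := by
    obtain ⟨v, hv, rfl, rfl, -⟩ := hp.exists_isPathFun
    set L := l.length - 1 with hL
    by_cases hall : ∀ i < L, G.Adj (v i) (v (i + 1))
    · have hseg := IsPathFun.segment (G := G) ⟨hall, hv.inj⟩ (Nat.zero_le L) le_rfl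
      by_cases h : G.Adj (v L) (v 0)
      · exact .inl ⟨_, hseg.isCycleList h, by simp; omega⟩
      · exact .inr ⟨_, _, _, hba.symm, fun h' => h h'.symm, hseg, by simp; omega⟩
    · push Not at hall
      obtain ⟨i, hi, hni⟩ := hall
      have hHi := hv.adj i hi
      have hedge : ∀ p q, H.Adj p q → ¬ G.Adj p q →
          p = v i ∧ q = v (i + 1) ∨ p = v (i + 1) ∧ q = v i := by
        intro p q hpq hpq'
        have h1 := hH p q hpq hpq'
        have h2 := hH _ _ hHi hni
        grind
      have h1 : IsPathList G (v (i + 1)) (v L) (segment v (i + 1) L) := by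
        refine (hv.segment hi le_rfl).of_forall_mem fun p hp q hq hpq => ?_
        by_contra hpq'
        have hm : v i ∈ segment v (i + 1) L := by
          rcases hedge p q hpq hpq' with ⟨rfl, rfl⟩ | ⟨rfl, rfl⟩ <;> assumption
        obtain ⟨k, hk, hkL, he⟩ := mem_segment.1 hm
        have := hv.inj _ hkL _ hi.le he
        omega
      have h2 : IsPathList G (v 0) (v i) (segment v 0 i) := by
        refine (hv.segment (Nat.zero_le i) hi.le).of_forall_mem fun p hp q hq hpq => ?_
        by_contra hpq'
        have hm : v (i + 1) ∈ segment v 0 i := by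
          rcases hedge p q hpq hpq' with ⟨rfl, rfl⟩ | ⟨rfl, rfl⟩ <;> assumption
        obtain ⟨k, hk, hkL, he⟩ := mem_segment.1 hm
        have := hv.inj _ (by omega) _ hi he
        omega
      have h3 : G.Adj (v L) (v 0) := by
        by_contra h
        rcases hedge _ _ hba h with ⟨h4, h5⟩ | ⟨h4, h5⟩
        · have := hv.inj _ le_rfl _ hi.le h4
          omega
        · have := hv.inj _ le_rfl _ hi h4
          have := hv.inj _ (Nat.zero_le L) _ hi.le h5
          omega
      refine .inr ⟨_, _, _, hHi.symm, fun h => hni h.symm, h1.append h2 h3 ?_, by simp; omega⟩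
      exact hv.disjoint_segment le_rfl hi.le (by omega)
  rcases key with h | ⟨p, q, l', hpq, hpq', hl', hlen'⟩
  · exact .inl h
  · rcases hH p q hpq hpq' with ⟨rfl, rfl⟩ | ⟨rfl, rfl⟩
    · exact .inr ⟨l', hl', hlen'⟩
    · exact .inr ⟨_, hl'.reverse, by simpa using hlen'⟩

/-- A bipartite graph on a finite vertex set without long cycles extends to a saturated one. -/
theorem exists_isSaturated [Finite V] (hs : 1 ≤ s) (hb : G.IsBipartiteWith X Y)
    (hG : NoLongCycle G s) :
    ∃ H, G ≤ H ∧ H.IsBipartiteWith X Y ∧ NoLongCycle H s ∧ IsSaturated H X Y s := by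
  obtain ⟨H, hGH, hH⟩ := (Set.toFinite
    {H : SimpleGraph V | H.IsBipartiteWith X Y ∧ NoLongCycle H s}).exists_le_maximal ⟨hb, hG⟩
  refine ⟨H, hGH, hH.prop.1, hH.prop.2, fun x hx y hy hxy => ?_⟩
  have hne := ne_of_mem hb hx hy
  have hadj : ∀ p q, (H ⊔ SimpleGraph.edge x y).Adj p q → ¬ H.Adj p q →
      p = x ∧ q = y ∨ p = y ∧ q = x := by
    intro p q hpq hpq'
    simp only [SimpleGraph.sup_adj, SimpleGraph.edge_adj] at hpq
    tauto
  have hnot : ¬ NoLongCycle (H ⊔ SimpleGraph.edge x y) s := by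
    intro hno
    have hle := hH.le_of_ge (y := H ⊔ SimpleGraph.edge x y) ⟨⟨hb.disjoint, ?_⟩, hno⟩ le_sup_left
    · exact hxy (hle (by simp [SimpleGraph.edge_adj, hne]))
    · intro p q hpq
      by_cases h : H.Adj p q
      · exact hH.prop.1.mem_of_adj h
      · rcases hadj p q hpq h with ⟨rfl, rfl⟩ | ⟨rfl, rfl⟩
        · exact .inl ⟨hx, hy⟩
        · exact .inr ⟨hy, hx⟩
  simp only [NoLongCycle, not_forall, not_lt] at hnot
  obtain ⟨l, hl, hlen⟩ := hnot
  rcases exists_path_of_cycle_sup_edge hl hadj (by omega) with ⟨l', hl', he⟩ | ⟨l', hl', he⟩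
  · have := hH.prop.2 l' hl'
    omega
  · exact ⟨l', hl', by omega⟩

theorem nbrs_card_le_nbrIndices {v : ℕ → V} {L : ℕ} {x : V} {l : List V} {A : Finset V}
    (hl : ∀ z, z ∈ l → ∃ i ≤ L, v i = z) (h : ∀ z ∈ nbrs G A x, z ∈ l) :
    #(nbrs G A x) ≤ #(nbrIndices G v L x) := by
  classical
  refine (card_le_card fun z hz => ?_).trans (card_image_le (f := v))
  obtain ⟨i, hi, rfl⟩ := hl z (h z hz)
  exact mem_image.2 ⟨i, by simpa [nbrIndices] using ⟨by omega, (mem_nbrs.1 hz).2⟩, rfl⟩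

/-- Kopylov's argument: in a saturated graph two subgraphs of large minimum degree are completely
joined to each other. -/
theorem adj_of_dense [Finite V] (hb : G.IsBipartiteWith X Y)
    (hcut : NoCutVertex G (X ∪ Y : Set V)) (hno : NoLongCycle G s) (hsat : IsSaturated G X Y s)
    {A B C D : Finset V} (hA : A ⊆ X) (hB : B ⊆ Y) (hC : C ⊆ X) (hD : D ⊆ Y) {a₁ b₁ a₂ b₂ : ℕ}
    (hAB : ∀ x ∈ A, a₁ ≤ #(nbrs G B x)) (hBA : ∀ y ∈ B, b₁ ≤ #(nbrs G A y))
    (hCD : ∀ x ∈ C, a₂ ≤ #(nbrs G D x)) (hDC : ∀ y ∈ D, b₂ ≤ #(nbrs G C y))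
    (haa : s + 3 ≤ a₁ + a₂) (hbb : s + 3 ≤ b₁ + b₂) (hab : s + 2 ≤ a₁ + b₂)
    (hba : s + 2 ≤ b₁ + a₂) {x y : V} (hx : x ∈ A) (hy : y ∈ D) : G.Adj x y := by
  classical
  have := Fintype.ofFinite V
  by_contra hxy
  let P : ℕ → Prop := fun n => ∃ a b l, IsPathList G a b l ∧ (a ∈ A ∨ a ∈ B) ∧ (b ∈ C ∨ b ∈ D) ∧
    l.length = n
  obtain ⟨l₀, hl₀, hlen₀⟩ := hsat x (hA hx) y (hD hy) hxy
  have hP₀ : P l₀.length := ⟨x, y, l₀, hl₀, .inl hx, .inr hy, rfl⟩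
  have hbound : ∀ n, P n → n ≤ Fintype.card V := by
    rintro n ⟨a, b, l, hl, -, -, rfl⟩
    exact hl.nodup.length_le_card
  obtain ⟨a, b, l, hl, ha, hb', hlen⟩ := Nat.findGreatest_spec (P := P) (hbound _ hP₀) hP₀
  have hmax : ∀ n, P n → n ≤ l.length := fun n hn =>
    hlen ▸ Nat.le_findGreatest (hbound _ hn) hn
  have hlong := hmax _ hP₀
  obtain ⟨v, hv, rfl, rfl, hmem⟩ := hl.exists_isPathFun
  set L := l.length - 1 with hL
  have hmem' : ∀ z, z ∈ l → ∃ i ≤ L, v i = z := fun z hz => by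
    obtain ⟨i, hi, rfl⟩ := (hmem z).1 hz
    exact ⟨i, by omega, rfl⟩
  have hext₀ : ∀ z, z ∈ A ∨ z ∈ B → G.Adj (v 0) z → z ∈ l := by
    intro z hz hadj
    by_contra hzl
    have := hmax _ ⟨_, _, _, hl.cons hadj.symm hzl, hz, hb', rfl⟩
    simp at this
  have hextL : ∀ z, z ∈ C ∨ z ∈ D → G.Adj (v L) z → z ∈ l := by
    intro z hz hadj
    by_contra hzl
    have := hmax _ ⟨_, _, _, hl.concat hadj hzl, ha, hz, rfl⟩
    simp at this
  have hdA : v 0 ∈ A → a₁ ≤ #(nbrIndices G v L (v 0)) := fun h =>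
    (hAB _ h).trans (nbrs_card_le_nbrIndices hmem' fun z hz =>
      hext₀ z (.inr (mem_nbrs.1 hz).1) (mem_nbrs.1 hz).2)
  have hdB : v 0 ∈ B → b₁ ≤ #(nbrIndices G v L (v 0)) := fun h =>
    (hBA _ h).trans (nbrs_card_le_nbrIndices hmem' fun z hz =>
      hext₀ z (.inl (mem_nbrs.1 hz).1) (mem_nbrs.1 hz).2)
  have hdC : v L ∈ C → a₂ ≤ #(nbrIndices G v L (v L)) := fun h =>
    (hCD _ h).trans (nbrs_card_le_nbrIndices hmem' fun z hz =>
      hextL z (.inr (mem_nbrs.1 hz).1) (mem_nbrs.1 hz).2)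
  have hdD : v L ∈ D → b₂ ≤ #(nbrIndices G v L (v L)) := fun h =>
    (hDC _ h).trans (nbrs_card_le_nbrIndices hmem' fun z hz =>
      hextL z (.inl (mem_nbrs.1 hz).1) (mem_nbrs.1 hz).2)
  have hW : ∀ k ≤ L, v k ∈ (X ∪ Y : Set V) := by
    intro k hk
    have : ∃ u, G.Adj (v k) u := by
      rcases hk.lt_or_eq with h | rfl
      · exact ⟨_, hv.adj k h⟩
      · have := hv.adj (L - 1) (by omega)
        rw [show L - 1 + 1 = L by omega] at this
        exact ⟨_, this.symm⟩
    obtain ⟨u, hu⟩ := this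
    rcases hb.mem_of_adj hu with h | h
    · exact .inl h.1
    · exact .inr h.1
  obtain ⟨c, hc, hclen⟩ := exists_cycle_of_path (s := s) hb hcut hv hW (by omega)
    (fun _ => by
      rcases ha with h | h <;> rcases hb' with h' | h'
      · have := hdA h; have := hdC h'; omega
      · have := hdA h; have := hdD h'; omega
      · have := hdB h; have := hdC h'; omega
      · have := hdB h; have := hdD h'; omega)
    (fun hLe => by
      obtain ⟨M, hM⟩ := hLe
      have hM2 : L = 2 * M := by omega
      rcases ha with h | h <;> rcases hb' with h' | h'
      · have := hdA h; have := hdC h'; omega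
      · have h1 := (hv.mem_of_even hb (hA h) M).1 hM2.ge
        rw [← hM2] at h1
        exact absurd rfl (ne_of_mem hb h1 (hD h'))
      · have h1 := (hv.mem_of_even hb.symm (hB h) M).1 hM2.ge
        rw [← hM2] at h1
        exact absurd rfl (ne_of_mem hb (hC h') h1)
      · have := hdB h; have := hdD h'; omega)
  have := hno c hc
  omega

end Saturated

section Balanced

variable {V : Type*} {G : SimpleGraph V} {X Y : Finset V} {s : ℕ}

theorem IsSaturated.symm (h : IsSaturated G X Y s) : IsSaturated G Y X s := fun y hy x hx hyx => by
  obtain ⟨l, hl, hlen⟩ := h x hx y hy fun h => hyx h.symm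
  exact ⟨_, hl.reverse, by simpa using hlen⟩

theorem le_card_nbrs {A B : Finset V} {x : V} (hB : A ⊆ B) (h : ∀ y ∈ A, G.Adj x y) :
    #A ≤ #(nbrs G B x) := card_le_card fun y hy => mem_nbrs.2 ⟨hB hy, h y hy⟩

theorem edgeCount_le_of_maximal_biclique [Finite V] (hs : 1 ≤ s) (hb : G.IsBipartiteWith X Y)
    (hcut : NoCutVertex G (X ∪ Y : Set V)) (hno : NoLongCycle G s) (hsat : IsSaturated G X Y s)
    (hXY : #X = #Y) (hsX : s + 1 ≤ #X) (hXs : #X ≤ 2 * s) {X₀ Y₀ : Finset V} (hX₀ : X₀ ⊆ X)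
    (hY₀ : Y₀ ⊆ Y) (hK : ∀ x ∈ X₀, ∀ y ∈ Y₀, G.Adj x y)
    (hmaxX : ∀ A, X₀ ⊆ A → A ⊆ X → (∀ x ∈ A, ∀ y ∈ Y₀, G.Adj x y) → A = X₀)
    (hmaxY : ∀ B, Y₀ ⊆ B → B ⊆ Y → (∀ x ∈ X₀, ∀ y ∈ B, G.Adj x y) → B = Y₀)
    (hp : s + 3 ≤ 2 * #X₀) (hpq : #X₀ ≤ #Y₀) : edgeCount G X Y + s ≤ (s + 1) * #X := by
  have hps : #X₀ ≤ s := by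
    by_contra! h
    obtain ⟨l, hl, hlen⟩ := exists_cycle_of_le_card_nbrs (G := between G X₀ Y) (X := X₀) (Y := Y)
      (s := s) (between_isBipartiteWith (disjoint_left.2 fun x hx hy =>
        ne_of_mem hb (hX₀ hx) hy rfl)) hs (fun x hx => by
        rw [nbrs_between hx]
        have := le_card_nbrs hY₀ (hK x hx)
        omega) (by omega) (by omega)
    have := hno.anti (between_le (X := X₀) (Y := Y)) l hl
    omega
  have hqn := card_le_card hY₀
  have key : ∀ α : ℕ, s + 2 ≤ α + #Y₀ → s + 1 ≤ α + #X₀ → α + 1 ≤ #Y₀ →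
      edgeCount G X Y ≤ #X₀ * #Y₀ + α * (#X - #X₀) + (s + 2 - #X₀) * (#Y - #Y₀) := by
    intro α h1 h2 h3
    refine edgeCount_le_of_removable _ _ hX₀ hY₀ fun A B hXA hAX hYB hBY hne => ?_
    by_contra! hcon
    obtain ⟨hA, hB⟩ := hcon
    have hAB : ∀ x ∈ A, α + 1 ≤ #(nbrs G B x) := by
      intro x hx
      by_cases hx0 : x ∈ X₀
      · exact h3.trans (le_card_nbrs hYB (hK x hx0))
      · exact hA x hx hx0
    have hBA : ∀ y ∈ B, s + 2 - #X₀ + 1 ≤ #(nbrs G A y) := by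
      intro y hy
      by_cases hy0 : y ∈ Y₀
      · have := le_card_nbrs hXA fun x hx => (hK x hx y hy0).symm
        omega
      · exact hB y hy hy0
    have hX₀Y₀ : ∀ x ∈ X₀, #Y₀ ≤ #(nbrs G Y₀ x) := fun x hx => le_card_nbrs subset_rfl (hK x hx)
    have hY₀X₀ : ∀ y ∈ Y₀, #X₀ ≤ #(nbrs G X₀ y) := fun y hy =>
      le_card_nbrs subset_rfl fun x hx => (hK x hx y hy).symm
    have hXB := hmaxY B hYB hBY fun x hx y hy => adj_of_dense hb hcut hno hsat hX₀ hY₀ hAX hBY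
      hX₀Y₀ hY₀X₀ hAB hBA (by omega) (by omega) (by omega) (by omega) hx hy
    have hAY := hmaxX A hXA hAX fun x hx y hy => adj_of_dense hb hcut hno hsat hAX hBY hX₀ hY₀
      hAB hBA hX₀Y₀ hY₀X₀ (by omega) (by omega) (by omega) (by omega) hx hy
    tauto
  rw [← hXY] at key hqn
  generalize #X = n at *
  generalize #X₀ = p at *
  generalize #Y₀ = q at *
  obtain ⟨r, rfl⟩ := Nat.exists_eq_add_of_le hps
  obtain ⟨j, rfl⟩ : ∃ j, p = r + 3 + j := Nat.exists_eq_add_of_le (by omega)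
  rcases hpq.lt_or_eq with h | rfl
  · have h1 := key (r + 1) (by omega) (by omega) (by omega)
    obtain ⟨m, rfl⟩ := Nat.exists_eq_add_of_le hqn
    obtain ⟨k, rfl⟩ := Nat.exists_eq_add_of_le h.le
    rw [show r + 3 + j + k + m - (r + 3 + j) = k + m by omega,
      show r + 3 + j + r + 2 - (r + 3 + j) = r + 2 by omega,
      show r + 3 + j + k + m - (r + 3 + j + k) = m by omega] at h1
    nlinarith
  · have h1 := key (r + 2) (by omega) (by omega) (by omega)
    obtain ⟨k, rfl⟩ := Nat.exists_eq_add_of_le hsX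
    rw [show r + 3 + j + r + 1 + k - (r + 3 + j) = r + 1 + k by omega,
      show r + 3 + j + r + 2 - (r + 3 + j) = r + 2 by omega] at h1
    nlinarith

theorem edgeCount_le_of_isSaturated [Finite V] (hs : 1 ≤ s) (hb : G.IsBipartiteWith X Y)
    (hcut : NoCutVertex G (X ∪ Y : Set V)) (hno : NoLongCycle G s) (hsat : IsSaturated G X Y s)
    (hXY : #X = #Y) (hsX : s + 1 ≤ #X) (hXs : #X ≤ 2 * s) :
    edgeCount G X Y + s ≤ (s + 1) * #X := by
  classical
  have := Fintype.ofFinite V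
  by_contra! hlt
  obtain ⟨α, β, hαβ, hα1, hα, hβ, hprod⟩ : ∃ α β, α + β = s + 1 ∧ 1 ≤ α ∧ s ≤ 2 * α ∧
      s + 1 ≤ 2 * β ∧ s ≤ α * β := by
    refine ⟨(s + 1) / 2, s / 2 + 1, by omega, by omega, by omega, by omega, ?_⟩
    obtain ⟨a, ha⟩ : ∃ a, (s + 1) / 2 = a + 1 := ⟨(s + 1) / 2 - 1, by omega⟩
    rw [ha]
    nlinarith [Nat.zero_le (a * (s / 2)), show s = a + 1 + s / 2 by omega]
  have hn : (s + 1) * #X = α * #X + β * #X := by rw [← hαβ, add_mul]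
  obtain ⟨A, hA, B, hB, -, ⟨y, hy⟩, hAB, hBA⟩ := exists_core (G := G) (X := X) (Y := Y) α β (by
    rw [← hXY, show β - #X = 0 by omega]
    omega)
  obtain ⟨C, hC, D, hD, ⟨x, hx⟩, -, hCD, hDC⟩ := exists_core (G := G) (X := X) (Y := Y) β α (by
    rw [← hXY, show β - #X = 0 by omega, mul_comm β α]
    omega)
  have hAD : ∀ x ∈ A, ∀ y ∈ D, G.Adj x y := fun x hx y hy =>
    adj_of_dense hb hcut hno hsat hA hB hC hD hAB hBA hCD hDC (by omega) (by omega) (by omega)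
      (by omega) hx hy
  have hcA : β + 1 ≤ #A := (hBA y hy).trans_le (card_le_card nbrs_subset)
  have hcD : β + 1 ≤ #D := (hCD x hx).trans_le (card_le_card nbrs_subset)
  obtain ⟨⟨X₀, Y₀⟩, ⟨hAX₀, hDY₀⟩, hmax⟩ := (Set.toFinite {P : Finset V × Finset V | P.1 ⊆ X ∧
    P.2 ⊆ Y ∧ ∀ x ∈ P.1, ∀ y ∈ P.2, G.Adj x y}).exists_le_maximal (a := (A, D)) ⟨hA, hD, hAD⟩
  obtain ⟨hX₀, hY₀, hK⟩ := hmax.prop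
  have hmaxX : ∀ S, X₀ ⊆ S → S ⊆ X → (∀ x ∈ S, ∀ y ∈ Y₀, G.Adj x y) → S = X₀ :=
    fun S h1 h2 h3 => (hmax.le_of_ge (y := (S, Y₀)) ⟨h2, hY₀, h3⟩ ⟨h1, le_rfl⟩).1.antisymm h1
  have hmaxY : ∀ S, Y₀ ⊆ S → S ⊆ Y → (∀ x ∈ X₀, ∀ y ∈ S, G.Adj x y) → S = Y₀ :=
    fun S h1 h2 h3 => (hmax.le_of_ge (y := (X₀, S)) ⟨hX₀, h2, h3⟩ ⟨le_rfl, h1⟩).2.antisymm h1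
  have hpX := card_le_card hAX₀
  have hpY := card_le_card hDY₀
  simp only at hX₀ hY₀ hK hpX hpY
  rcases le_total #X₀ #Y₀ with h | h
  · have := edgeCount_le_of_maximal_biclique hs hb hcut hno hsat hXY hsX hXs hX₀ hY₀ hK hmaxX hmaxY
      (by omega) h
    omega
  · have := edgeCount_le_of_maximal_biclique hs hb.symm (Set.union_comm _ _ ▸ hcut) hno hsat.symm
      hXY.symm (by omega) (by omega) hY₀ hX₀ (fun y hy x hx => (hK x hx y hy).symm)
      (fun S h1 h2 h3 => hmaxY S h1 h2 fun x hx y hy => (h3 y hy x hx).symm)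
      (fun S h1 h2 h3 => hmaxX S h1 h2 fun x hx y hy => (h3 y hy x hx).symm) (by omega) h
    rw [edgeCount_comm, ← hXY] at this
    omega

end Balanced

section Blocks

variable {V : Type*} {G : SimpleGraph V} {X Y : Finset V} {s : ℕ}

theorem exists_cut_of_not_noCutVertex [DecidableEq V] (h3 : 3 ≤ #(X ∪ Y))
    (hcut : ¬ NoCutVertex G (X ∪ Y : Set V)) :
    ∃ w ∈ X ∪ Y, ∃ S ⊆ X ∪ Y, S.Nonempty ∧ w ∉ S ∧ (∃ z ∈ X ∪ Y, z ∉ S ∧ z ≠ w) ∧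
      ∀ a ∈ S, ∀ b ∈ X ∪ Y, b ∉ S → b ≠ w → ¬ G.Adj a b := by
  classical
  simp only [NoCutVertex] at hcut
  push Not at hcut
  obtain ⟨w, S, hS, ⟨a, ha⟩, hw, ⟨z, hz, hzS, hzw⟩, h⟩ := hcut
  have memXY : ∀ v, v ∈ (X ∪ Y : Set V) ↔ v ∈ X ∪ Y := by simp
  by_cases hwW : w ∈ X ∪ Y
  · refine ⟨w, hwW, {x ∈ X ∪ Y | x ∈ S}, filter_subset _ _,
      ⟨a, mem_filter.2 ⟨(memXY a).1 (hS ha), ha⟩⟩, fun hw' => hw (mem_filter.1 hw').2,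
      ⟨z, (memXY z).1 hz, fun hz' => hzS (mem_filter.1 hz').2, hzw⟩, ?_⟩
    intro a ha b hb hbS hbw
    exact h a (mem_filter.1 ha).2 b ((memXY b).2 hb) (fun h' => hbS (mem_filter.2 ⟨hb, h'⟩)) hbw
  · obtain ⟨w', hw', hne⟩ : ∃ w' ∈ X ∪ Y, w' ∉ ({a, z} : Finset V) := by
      by_contra! hsub
      have h1 := card_le_card (show X ∪ Y ⊆ {a, z} from hsub)
      have h2 := card_le_two (a := a) (b := z)
      omega
    simp only [mem_insert, mem_singleton, not_or] at hne
    refine ⟨w', hw', {x ∈ X ∪ Y | x ∈ S ∧ x ≠ w'}, filter_subset _ _,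
      ⟨a, mem_filter.2 ⟨(memXY a).1 (hS ha), ha, Ne.symm hne.1⟩⟩,
      fun h' => (mem_filter.1 h').2.2 rfl,
      ⟨z, (memXY z).1 hz, fun hz' => hzS (mem_filter.1 hz').2.1, Ne.symm hne.2⟩, ?_⟩
    intro a ha b hb hbS hbw
    exact h a (mem_filter.1 ha).2.1 b ((memXY b).2 hb)
      (fun h' => hbS (mem_filter.2 ⟨hb, h', hbw⟩)) (fun h' => hwW (h' ▸ hb))

theorem edgeCount_le_add_of_cut [DecidableEq V] {w : V} {S : Finset V} (hd : Disjoint X Y)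
    (hw : w ∈ X) (hwS : w ∉ S)
    (h : ∀ a ∈ S, ∀ b ∈ X ∪ Y, b ∉ S → b ≠ w → ¬ G.Adj a b) :
    edgeCount G X Y ≤
      edgeCount G (insert w (X ∩ S)) (Y ∩ S) + edgeCount G (X \ S) (Y \ S) := by
  have hY : ∀ {y}, y ∈ Y → y ≠ w := fun hy h => disjoint_left.1 hd hw (h ▸ hy)
  have hwX : w ∉ X ∩ S := fun h => hwS (mem_inter.1 h).2
  have hwX' : w ∈ X \ S := mem_sdiff.2 ⟨hw, hwS⟩
  have h1 : ∑ x ∈ X ∩ S, #(nbrs G Y x) ≤ ∑ x ∈ X ∩ S, #(nbrs G (Y ∩ S) x) := by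
    refine sum_le_sum fun x hx => card_le_card fun y hy => ?_
    rw [mem_nbrs] at hy ⊢
    refine ⟨mem_inter.2 ⟨hy.1, ?_⟩, hy.2⟩
    by_contra hyS
    exact h x (mem_inter.1 hx).2 y (mem_union_right _ hy.1) hyS (hY hy.1) hy.2
  have h2 : ∑ x ∈ (X \ S).erase w, #(nbrs G Y x) ≤
      ∑ x ∈ (X \ S).erase w, #(nbrs G (Y \ S) x) := by
    refine sum_le_sum fun x hx => card_le_card fun y hy => ?_
    rw [mem_nbrs] at hy ⊢
    refine ⟨mem_sdiff.2 ⟨hy.1, fun hyS => ?_⟩, hy.2⟩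
    have hx' := mem_sdiff.1 (mem_erase.1 hx).2
    exact h y hyS x (mem_union_left _ hx'.1) hx'.2 (mem_erase.1 hx).1 hy.2.symm
  have h3 : #(nbrs G Y w) ≤ #(nbrs G (Y ∩ S) w) + #(nbrs G (Y \ S) w) := by
    refine (card_le_card fun y hy => ?_).trans (card_union_le _ _)
    simp only [mem_union, mem_nbrs, mem_inter, mem_sdiff] at hy ⊢
    tauto
  have e1 := edgeCount_erase_left (G := G) (Y := Y) hwX'
  have e2 := edgeCount_erase_left (G := G) (Y := Y \ S) hwX'
  have e3 : edgeCount G X Y = ∑ x ∈ X ∩ S, #(nbrs G Y x) + edgeCount G (X \ S) Y :=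
    (sum_inter_add_sum_sdiff X S _).symm
  have e4 : edgeCount G (insert w (X ∩ S)) (Y ∩ S) =
      #(nbrs G (Y ∩ S) w) + ∑ x ∈ X ∩ S, #(nbrs G (Y ∩ S) x) := sum_insert hwX
  simp only [edgeCount] at *
  omega

theorem sum_le_of_block_bounds {a b q d e f s : ℕ} (hs : 1 ≤ s) (hsum : q + d = a + b + 1)
    (hn : a + b + 1 ≤ 2 * s) (hqa : q ≤ a + 1) (hbd : b + 1 < d) (he : e ≤ s * a + q)
    (he' : e ≤ (a + 1) * q) (hf : f ≤ s * (d - 1) + (b + 1)) (hf' : f ≤ (b + 1) * d) :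
    e + f ≤ s * (a + b) + (a + b + 1) := by
  obtain ⟨c, rfl⟩ : ∃ c, d = c + 1 := ⟨d - 1, by omega⟩
  obtain ⟨k, rfl⟩ : ∃ k, c = b + k := ⟨c - b, by omega⟩
  obtain rfl : a = q + k := by omega
  rw [Nat.add_sub_cancel] at hf
  rcases le_or_gt s q with hq | hq
  · have : b * (b + k + 1) ≤ b * s := Nat.mul_le_mul_left b (by omega)
    nlinarith
  rcases le_or_gt s (b + 1) with hb | hb
  · have : q * (q + k) ≤ q * s := Nat.mul_le_mul_left q (by omega)
    nlinarith
  obtain ⟨u, rfl⟩ := Nat.exists_eq_add_of_le hq.le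
  obtain ⟨w, hw⟩ := Nat.exists_eq_add_of_le hb.le
  have hk : k ≤ u + w := by omega
  have key : (q + b) * k ≤ (q + u) * k + q * u + b * w := by
    rcases le_or_gt b u with hbu | hub
    · have : b * k ≤ u * k := Nat.mul_le_mul_right k hbu
      nlinarith
    · obtain ⟨r, rfl⟩ := Nat.exists_eq_add_of_le hub.le
      obtain rfl : q = r + 1 + w := by omega
      have : r * k ≤ r * (u + w) := Nat.mul_le_mul_left r hk
      nlinarith
  have hw' : b * (q + u) = b * (b + 1 + w) := by rw [hw]
  nlinarith

theorem edgeCount_le_of_cut [DecidableEq V] {w : V} {S : Finset V} (hd : Disjoint X Y)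
    (hs : 1 ≤ s) (hXY : #X = #Y) (hXs : #X ≤ 2 * s)
    (ih : ∀ A ⊆ X, ∀ B ⊆ Y, #A + #B < #X + #Y →
      (A.Nonempty → #B ≤ #A → edgeCount G A B ≤ s * (#A - 1) + #B) ∧
      (B.Nonempty → #A ≤ #B → edgeCount G A B ≤ s * (#B - 1) + #A))
    (hSW : S ⊆ X ∪ Y) (hS : S.Nonempty) (hw : w ∈ X) (hwS : w ∉ S)
    (hz : ∃ z ∈ X ∪ Y, z ∉ S ∧ z ≠ w)
    (h : ∀ a ∈ S, ∀ b ∈ X ∪ Y, b ∉ S → b ≠ w → ¬ G.Adj a b) :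
    edgeCount G X Y ≤ s * (#X - 1) + #Y := by
  have hle := edgeCount_le_add_of_cut hd hw hwS h
  have hwX : w ∉ X ∩ S := fun h => hwS (mem_inter.1 h).2
  have c1 := card_insert_of_notMem hwX
  have c2 := card_inter_add_card_sdiff X S
  have c3 := card_inter_add_card_sdiff Y S
  have c4 : 1 ≤ #(X \ S) := card_pos.2 ⟨w, mem_sdiff.2 ⟨hw, hwS⟩⟩
  have c5 : 1 ≤ #(X ∩ S) + #(Y ∩ S) := by
    obtain ⟨a, ha⟩ := hS
    rcases mem_union.1 (hSW ha) with h | h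
    · have := card_pos.2 ⟨a, mem_inter.2 ⟨h, ha⟩⟩
      omega
    · have := card_pos.2 ⟨a, mem_inter.2 ⟨h, ha⟩⟩
      omega
  have c6 : 2 ≤ #(X \ S) + #(Y \ S) := by
    obtain ⟨z, hz, hzS, hzw⟩ := hz
    rcases mem_union.1 hz with h | h
    · have := one_lt_card.2 ⟨z, mem_sdiff.2 ⟨h, hzS⟩, w, mem_sdiff.2 ⟨hw, hwS⟩, hzw⟩
      omega
    · have := card_pos.2 ⟨z, mem_sdiff.2 ⟨h, hzS⟩⟩
      omega
  have i1 := ih (insert w (X ∩ S)) (insert_subset hw inter_subset_left) (Y ∩ S)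
    inter_subset_left (by omega)
  have i2 := ih (X \ S) sdiff_subset (Y \ S) sdiff_subset (by omega)
  have j1 := edgeCount_le_mul (G := G) (X := insert w (X ∩ S)) (Y := Y ∩ S)
  have j2 := edgeCount_le_mul (G := G) (X := X \ S) (Y := Y \ S)
  obtain ⟨b, hb⟩ : ∃ b, #(X \ S) = b + 1 := ⟨#(X \ S) - 1, by omega⟩
  rw [← card_pos, ← card_pos, c1] at i1
  rw [← card_pos, ← card_pos, hb] at i2
  rw [c1] at j1
  rw [hb] at j2
  have hX1 : #X - 1 = #(X ∩ S) + b := by omega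
  rw [hX1]
  rcases le_or_gt #(Y ∩ S) (#(X ∩ S) + 1) with h1 | h1
  · have k1 := i1.1 (by omega) h1
    rw [Nat.add_sub_cancel] at k1
    rcases le_or_gt #(Y \ S) (b + 1) with h2 | h2
    · have k2 := i2.1 (by omega) h2
      rw [Nat.add_sub_cancel] at k2
      rw [mul_add]
      omega
    · have := sum_le_of_block_bounds hs (by omega) (by omega) h1 h2 k1 j1
        (i2.2 (by omega) h2.le) j2
      omega
  · have k2 := i2.1 (by omega) (by omega)
    rw [Nat.add_sub_cancel] at k2
    have := sum_le_of_block_bounds hs (by omega) (by omega) (by omega) h1 k2 j2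
        (i1.2 (by omega) h1.le) j1
    rw [add_comm #(X ∩ S) b]
    omega

/-- Jackson's bound when the smaller side has at most `2 * s` vertices. -/
theorem edgeCount_le_of_card_le [Finite V] (hs : 1 ≤ s) (hb : G.IsBipartiteWith X Y)
    (hno : NoLongCycle G s) (hX : X.Nonempty) (hYX : #Y ≤ #X) (hYs : #Y ≤ 2 * s) :
    edgeCount G X Y ≤ s * (#X - 1) + #Y := by
  classical
  induction hN : #X + #Y using Nat.strong_induction_on generalizing G X Y with
  | _ N ih =>
  have hd : Disjoint X Y := by exact_mod_cast hb.disjoint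
  have hpos := card_pos.2 hX
  have ih' : ∀ {H : SimpleGraph V} {A B : Finset V}, NoLongCycle H s → Disjoint A B →
      A.Nonempty → #B ≤ #A → #B ≤ 2 * s → #A + #B < N →
      edgeCount H A B ≤ s * (#A - 1) + #B := by
    intro H A B hH hAB hA hBA hBs hlt
    rw [← edgeCount_between]
    exact ih _ hlt (between_isBipartiteWith hAB) (hH.anti between_le) hA hBA hBs rfl
  rcases hYX.lt_or_eq with hlt | heq
  · rcases Nat.eq_zero_or_pos #Y with h0 | h0
    · refine edgeCount_le_mul.trans ?_
      simp [h0]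
    by_cases hx : ∃ x ∈ X, #(nbrs G Y x) ≤ s
    · obtain ⟨x, hx, hdeg⟩ := hx
      have hc := card_erase_add_one hx
      have := ih' (A := X.erase x) (B := Y) hno (hd.mono_left (erase_subset _ _))
        (card_pos.1 (by omega)) (by omega) hYs (by omega)
      have he := edgeCount_erase_left (G := G) (Y := Y) hx
      obtain ⟨k, hk⟩ : ∃ k, #(X.erase x) = k + 1 := ⟨#(X.erase x) - 1, by omega⟩
      rw [show #X - 1 = k + 1 by omega, mul_add]
      rw [hk, Nat.add_sub_cancel] at this
      omega
    · push Not at hx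
      obtain ⟨x, hxX⟩ := hX
      have h1 := hx x hxX
      have h2 : #(nbrs G Y x) ≤ #Y := card_le_card nbrs_subset
      obtain ⟨l, hl, hlen⟩ := exists_cycle_of_le_card_nbrs hb hs hx hYs (by omega)
      have := hno l hl
      omega
  · rcases le_or_gt #X s with hXs | hsX
    · refine edgeCount_le_mul.trans ?_
      obtain ⟨k, hk⟩ : ∃ k, #X = k + 1 := ⟨#X - 1, by omega⟩
      rw [heq, hk, Nat.add_sub_cancel]
      nlinarith
    · obtain ⟨H, hGH, hHb, hHno, hsat⟩ := exists_isSaturated hs hb hno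
      refine (edgeCount_mono hGH).trans ?_
      by_cases hcut : NoCutVertex H (X ∪ Y : Set V)
      · have := edgeCount_le_of_isSaturated hs hHb hcut hHno hsat heq.symm hsX (by omega)
        obtain ⟨k, hk⟩ : ∃ k, #X = k + 1 := ⟨#X - 1, by omega⟩
        rw [heq, hk, Nat.add_sub_cancel]
        rw [hk] at this
        nlinarith
      · have hcard := card_union_of_disjoint hd
        obtain ⟨w, hw, S, hSW, hS, hwS, hz, h⟩ :=
          exists_cut_of_not_noCutVertex (by omega) hcut
        have ih₂ : ∀ A ⊆ X, ∀ B ⊆ Y, #A + #B < #X + #Y →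
            (A.Nonempty → #B ≤ #A → edgeCount H A B ≤ s * (#A - 1) + #B) ∧
            (B.Nonempty → #A ≤ #B → edgeCount H A B ≤ s * (#B - 1) + #A) := by
          intro A hA B hB hlt
          have c1 := card_le_card hA
          have c2 := card_le_card hB
          have hAB := (hd.mono_left hA).mono_right hB
          refine ⟨fun hA hBA => ih' hHno hAB hA hBA (by omega) (by omega), fun hB hAB' => ?_⟩
          rw [edgeCount_comm]
          exact ih' hHno hAB.symm hB hAB' (by omega) (by omega)
        rcases mem_union.1 hw with hwX | hwY
        · exact edgeCount_le_of_cut hd hs heq.symm (by omega) ih₂ hSW hS hwX hwS hz h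
        · rw [edgeCount_comm, ← heq]
          nth_rewrite 2 [heq]
          rw [union_comm] at hSW hz h
          refine edgeCount_le_of_cut hd.symm hs heq (by omega) (fun A hA B hB hlt => ?_) hSW hS
            hwY hwS hz h
          rw [edgeCount_comm]
          exact (ih₂ B hB A hA (by omega)).symm

end Blocks

section MinDegree

variable {V : Type*} {G : SimpleGraph V} {X Y : Finset V} {s : ℕ}

theorem exists_longest_isPathList [Finite V] [Nonempty V] :
    ∃ a b l, IsPathList G a b l ∧ ∀ a' b' l', IsPathList G a' b' l' → l'.length ≤ l.length := by
  classical
  have := Fintype.ofFinite V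
  let P : ℕ → Prop := fun k => ∃ a b l, IsPathList G a b l ∧ l.length = k
  have hle : ∀ {a b l}, IsPathList G a b l → l.length ≤ Fintype.card V :=
    fun h => h.nodup.length_le_card
  obtain ⟨v⟩ := ‹Nonempty V›
  have h1 : P 1 := ⟨v, v, [v], IsPathList.single v, rfl⟩
  obtain ⟨a, b, l, hl, hlen⟩ := Nat.findGreatest_spec (hle (IsPathList.single (G := G) v)) h1
  exact ⟨a, b, l, hl, fun a' b' l' h' =>
    hlen ▸ Nat.le_findGreatest (hle h') ⟨a', b', l', h', rfl⟩⟩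

theorem exists_cycle_of_nbrs_subset_path (hb : G.IsBipartiteWith X Y) {v : ℕ → V} {L : ℕ}
    (hv : IsPathFun G v L) (h0 : v 0 ∈ X) (hdeg : s + 1 ≤ #(nbrs G Y (v 0)))
    (hsub : ∀ y, G.Adj (v 0) y → ∃ i ≤ L, v i = y) :
    ∃ l, IsCycleList G l ∧ 2 * s + 2 ≤ l.length := by
  classical
  by_contra! hno
  have hi : ∀ i ≤ L, G.Adj (v 0) (v i) → i < 2 * s + 1 := by
    intro i hi hadj
    have := hno _ ((hv.segment (Nat.zero_le i) hi).isCycleList hadj.symm)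
    simp at this
    omega
  have hle : nbrs G Y (v 0) ⊆ (range s).image fun j => v (2 * j + 1) := by
    intro y hy
    obtain ⟨i, hiL, rfl⟩ := hsub y (mem_nbrs.1 hy).2
    have h1 := hi i hiL (mem_nbrs.1 hy).2
    rcases Nat.even_or_odd' i with ⟨j, rfl | rfl⟩
    · exact absurd rfl (ne_of_mem hb ((hv.mem_of_even hb h0 j).1 hiL) (mem_nbrs.1 hy).1)
    · exact mem_image.2 ⟨j, mem_range.2 (by omega), rfl⟩
  have h2 := (card_le_card hle).trans card_image_le
  rw [card_range] at h2
  omega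

theorem exists_cycle_of_forall_le_card_nbrs [Finite V] (hb : G.IsBipartiteWith X Y)
    (hX : X.Nonempty) (hXdeg : ∀ x ∈ X, s + 1 ≤ #(nbrs G Y x))
    (hYdeg : ∀ y ∈ Y, s + 1 ≤ #(nbrs G X y)) : ∃ l, IsCycleList G l ∧ 2 * s + 2 ≤ l.length := by
  obtain ⟨x₀, hx₀⟩ := hX
  have : Nonempty V := ⟨x₀⟩
  obtain ⟨a, b, l, hl, hmax⟩ := exists_longest_isPathList (G := G)
  obtain ⟨v, hv, hva, -, hvl⟩ := hl.exists_isPathFun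
  have hadj : ∀ y, G.Adj (v 0) y → ∃ i ≤ l.length - 1, v i = y := by
    intro y hy
    have hyl : y ∈ l := by
      by_contra hyl
      have := hmax _ _ _ (hl.cons (hva ▸ hy.symm) hyl)
      simp at this
    obtain ⟨i, hi, rfl⟩ := (hvl y).1 hyl
    exact ⟨i, by omega, rfl⟩
  have hv0 : v 0 ∈ X ∨ v 0 ∈ Y := by
    obtain ⟨y, hy⟩ := card_pos.1 (lt_of_lt_of_le s.succ_pos (hXdeg x₀ hx₀))
    have h2 := hmax _ _ _ ((IsPathList.single y).cons (mem_nbrs.1 hy).2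
      (by simpa using (mem_nbrs.1 hy).2.ne))
    simp at h2
    rcases hb.mem_of_adj (hv.adj 0 (by omega)) with h | h
    · exact Or.inl h.1
    · exact Or.inr h.1
  rcases hv0 with h | h
  · exact exists_cycle_of_nbrs_subset_path hb hv h (hXdeg _ h) hadj
  · exact exists_cycle_of_nbrs_subset_path hb.symm hv h (hYdeg _ h) hadj

/-- Jackson's bound when both sides have at least `2 * s` vertices. -/
theorem edgeCount_le_of_le_card [Finite V] (hs : 1 ≤ s) (hb : G.IsBipartiteWith X Y)
    (hno : NoLongCycle G s) (hX : 2 * s ≤ #X) (hY : 2 * s ≤ #Y) :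
    edgeCount G X Y ≤ s * (#X + #Y + 1 - 2 * s) := by
  classical
  induction hN : #X + #Y using Nat.strong_induction_on generalizing G X Y with
  | _ N ih =>
  have hd : Disjoint X Y := by exact_mod_cast hb.disjoint
  have base : ∀ {A B : Finset V}, G.IsBipartiteWith A B → 2 * s ≤ #A → #B = 2 * s →
      edgeCount G A B ≤ s * (#A + #B + 1 - 2 * s) := by
    intro A B hAB hA hB
    have := edgeCount_le_of_card_le hs hAB hno (card_pos.1 (by omega)) (by omega) hB.le
    obtain ⟨k, hk⟩ : ∃ k, #A = k + 1 := ⟨#A - 1, by omega⟩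
    rw [hB, show #A + 2 * s + 1 - 2 * s = k + 2 by omega]
    rw [hk, hB, Nat.add_sub_cancel] at this
    linarith
  have step : ∀ {A B : Finset V} {x : V}, Disjoint A B → x ∈ A → #(nbrs G B x) ≤ s →
      2 * s < #A → 2 * s ≤ #B → #A + #B = N →
      edgeCount G A B ≤ s * (#A + #B + 1 - 2 * s) := by
    intro A B x hAB hx hdeg hA hB hN
    have hc := card_erase_add_one hx
    have he := edgeCount_erase_left (G := G) (Y := B) hx
    have := ih _ (by omega) (between_isBipartiteWith (hAB.mono_left (erase_subset x A)))
      (hno.anti between_le) (by omega) hB rfl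
    rw [edgeCount_between] at this
    rw [show #A + #B + 1 - 2 * s = (#(A.erase x) + #B + 1 - 2 * s) + 1 by omega, mul_add]
    omega
  rcases hY.eq_or_lt with h | hY'
  · rw [← hN]; exact base hb hX h.symm
  rcases hX.eq_or_lt with h | hX'
  · rw [edgeCount_comm, ← hN, add_comm #X]; exact base hb.symm hY h.symm
  by_cases hx : ∃ x ∈ X, #(nbrs G Y x) ≤ s
  · obtain ⟨x, hx, hdeg⟩ := hx
    rw [← hN]
    exact step hd hx hdeg hX' hY hN
  by_cases hy : ∃ y ∈ Y, #(nbrs G X y) ≤ s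
  · obtain ⟨y, hy, hdeg⟩ := hy
    rw [edgeCount_comm, ← hN, add_comm #X]
    exact step hd.symm hy hdeg hY' hX (by omega)
  push Not at hx hy
  obtain ⟨l, hl, hlen⟩ :=
    exists_cycle_of_forall_le_card_nbrs hb (card_pos.1 (by omega)) hx hy
  have := hno l hl
  omega

end MinDegree

section Walks

variable {V : Type*} {G : SimpleGraph V} {X Y : Finset V}

theorem IsPathList.exists_walk {a b : V} {l : List V} (h : IsPathList G a b l) :
    ∃ p : G.Walk a b, p.support = l := by
  induction l generalizing a with
  | nil => exact absurd rfl h.ne_nil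
  | cons c l ih =>
    obtain rfl : c = a := by simpa using h.head
    cases l with
    | nil =>
      obtain rfl : c = b := by simpa using h.last
      exact ⟨.nil, rfl⟩
    | cons d l =>
      obtain ⟨p, hp⟩ := ih (IsPathList.right_of_append (l₁ := [c]) h)
      have hcd : G.Adj c d := (List.isChain_cons_cons.1 h.chain).1
      exact ⟨.cons hcd p, by simp [hp]⟩

theorem IsCycleList.exists_isCycle {l : List V} (h : IsCycleList G l) (hl : 3 ≤ l.length) :
    ∃ (v : V) (w : G.Walk v v), w.IsCycle ∧ w.length = l.length := by
  obtain ⟨a, b, hp, hba⟩ := h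
  obtain ⟨p, rfl⟩ := hp.exists_walk
  have hpath : p.IsPath := ⟨⟨SimpleGraph.Walk.edges_nodup_of_support_nodup hp.nodup⟩, hp.nodup⟩
  refine ⟨b, .cons hba p, (SimpleGraph.Walk.cons_isCycle_iff p hba).2 ⟨hpath, fun he => ?_⟩,
    by simp⟩
  have := hpath.length_eq_one_of_mem_edges (Sym2.eq_swap ▸ he)
  rw [SimpleGraph.Walk.length_support] at hl
  omega

theorem ncard_edgeSet_le_edgeCount (hb : G.IsBipartiteWith X Y) :
    G.edgeSet.ncard ≤ edgeCount G X Y := by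
  classical
  have hsub : G.edgeSet ⊆ ((X.sigma fun x => nbrs G Y x).image fun p => s(p.1, p.2) :
      Finset (Sym2 V)) := by
    intro e he
    induction e with
    | _ u v =>
    rw [SimpleGraph.mem_edgeSet] at he
    simp only [coe_image, Set.mem_image, mem_coe, mem_sigma, mem_nbrs]
    rcases hb.mem_of_adj he with h | h
    · exact ⟨⟨u, v⟩, ⟨h.1, h.2, he⟩, rfl⟩
    · exact ⟨⟨v, u⟩, ⟨h.2, h.1, he.symm⟩, Sym2.eq_swap⟩
  refine (Set.ncard_le_ncard hsub (finite_toSet _)).trans ?_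
  rw [Set.ncard_coe_finset]
  refine card_image_le.trans ?_
  rw [card_sigma, edgeCount]

end Walks

end JacksonCycle

open JacksonCycle Finset in
/-- **Theorem (Jackson 1985).** Let `G = (X,Y;E)` be a bipartite graph with `|X| = n`,
`|Y| = m`, where `n ≥ m ≥ t ≥ 2`. If either `m ≤ 2t - 2` and `e(G) > (n-1)(t-1) + m`, or
`m ≥ 2t - 2` and `e(G) > (m + n - 2t + 3)(t-1)`, then `G` contains a cycle of length at
least `2t`. -/
theorem stmt_13 {V : Type} [Fintype V] [DecidableEq V]
    (G : SimpleGraph V) (X Y : Finset V) (n m t : ℕ)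
    (hpart : ∀ v : V, v ∈ X ∨ v ∈ Y) (hdisj : Disjoint X Y)
    (hbip : ∀ u v : V, G.Adj u v → (u ∈ X ∧ v ∈ Y) ∨ (u ∈ Y ∧ v ∈ X))
    (hX : X.card = n) (hY : Y.card = m)
    (hmn : m ≤ n) (htm : t ≤ m) (ht : 2 ≤ t)
    (he : (m ≤ 2 * t - 2 ∧ (n - 1) * (t - 1) + m < G.edgeSet.ncard) ∨
          (2 * t - 2 ≤ m ∧ (m + n - 2 * t + 3) * (t - 1) < G.edgeSet.ncard)) :
    ∃ (v : V) (w : G.Walk v v), w.IsCycle ∧ 2 * t ≤ w.length := by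
  obtain ⟨s, rfl⟩ : ∃ s, t = s + 1 := ⟨t - 1, by omega⟩
  have hb : G.IsBipartiteWith X Y := ⟨by exact_mod_cast hdisj, fun u v h => hbip u v h⟩
  by_contra! hcon
  have hno : NoLongCycle G s := by
    intro l hl
    by_contra! hlen
    obtain ⟨v, w, hw, hwl⟩ := hl.exists_isCycle (by omega)
    have := hcon v w hw
    omega
  have hle := ncard_edgeSet_le_edgeCount hb
  subst hX hY
  rw [Nat.add_sub_cancel] at he
  rcases he with ⟨h1, h2⟩ | ⟨h1, h2⟩
  · have := edgeCount_le_of_card_le (by omega) hb hno (card_pos.1 (by omega)) hmn (by omega)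
    rw [mul_comm] at h2
    omega
  · have := edgeCount_le_of_le_card (by omega) hb hno (by omega) (by omega)
    rw [mul_comm, show #Y + #X - 2 * (s + 1) + 3 = #X + #Y + 1 - 2 * s by omega] at h2
    omega
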